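/- Let G = (V,E) be a triangulated Laman graph on N ≥ 2 vertices, and suppose the ensemble of interaction laws (f_ij)_{(i,j)∈E} lies in 𝓕^{|E|}. Then generically (i.e., for all ensembles in a subset of 𝓕^{|E|} containing an open dense set) the potential function Φ is an equivariant Morse function: the RMA system has only finitely many critical orbits, and every critical orbit O_p is nondegenerate, i.e. the Hessian H_p of Φ at p has exactly three zero eigenvalues. -/

import Mathlib

open Set Filter Topology MeasureTheory Matrix Function

attribute [local instance] Classical.propDecidable

noncomputable section

/-- `f̃(d) = d * f(d)`. -/
def tildeFn (f : ℝ → ℝ) : ℝ → ℝ := fun d => d * f d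

/-- Membership in the class `𝓕` of monotone interaction laws:
`f` is `C¹` on `ℝ₊ = (0,∞)`, `f̃′ > 0` on `ℝ₊`, `f̃` has a zero, and
`∫_d^1 f̃(x) dx → −∞` as `d → 0⁺`. -/
def MemF (f : ℝ → ℝ) : Prop :=
  ContDiffOn ℝ 1 f (Set.Ioi 0) ∧
  (∀ d > (0:ℝ), 0 < deriv (tildeFn f) d) ∧
  (∃ d > (0:ℝ), tildeFn f d = 0) ∧
  Tendsto (fun d => ∫ x in d..(1:ℝ), tildeFn f x) (𝓝[>] (0:ℝ)) atBot

/-- The space `C¹(ℝ₊, ℝ)`. -/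
def C1Pos : Type := {f : ℝ → ℝ // ContDiffOn ℝ 1 f (Set.Ioi 0)}

/-- The Whitney `C¹`-topology on `C¹(ℝ₊, ℝ)`, generated by the basic open sets
`B_δ(f) = {g : |g(d) − f(d)| + |g′(d) − f′(d)| < δ(d) for all d > 0}`. -/
instance : TopologicalSpace C1Pos :=
  TopologicalSpace.generateFrom
    { S | ∃ (f : C1Pos) (δ : ℝ → ℝ), ContinuousOn δ (Set.Ioi 0) ∧ (∀ d > (0:ℝ), 0 < δ d) ∧
        S = { g : C1Pos | ∀ d > (0:ℝ), |g.1 d - f.1 d| + |deriv g.1 d - deriv f.1 d| < δ d } }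

/-- The class `𝓕` as a topological space (subspace of `C¹(ℝ₊,ℝ)`). -/
def FF : Type := {f : C1Pos // MemF f.1}

instance : TopologicalSpace FF := instTopologicalSpaceSubtype

/-- `G` is a triangulated Laman graph: there is a Henneberg-type construction order
(a relabeling `σ`) starting from the edge between the first two vertices, in which every
later vertex is joined to exactly two earlier, adjacent, vertices. -/
def IsTLG {N : ℕ} (G : SimpleGraph (Fin N)) : Prop :=
  2 ≤ N ∧
  ∃ (σ : Equiv.Perm (Fin N)) (par₁ par₂ : Fin N → Fin N),
    (∀ k : Fin N, 2 ≤ (k : ℕ) →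
      ((par₁ k : ℕ) < (k : ℕ) ∧ (par₂ k : ℕ) < (k : ℕ) ∧ par₁ k ≠ par₂ k ∧
        G.Adj (σ (par₁ k)) (σ (par₂ k)))) ∧
    (∀ i j : Fin N, G.Adj (σ i) (σ j) ↔
      (((i : ℕ) = 0 ∧ (j : ℕ) = 1) ∨ ((i : ℕ) = 1 ∧ (j : ℕ) = 0) ∨
       (2 ≤ (i : ℕ) ∧ (j = par₁ i ∨ j = par₂ i)) ∨
       (2 ≤ (j : ℕ) ∧ (i = par₁ j ∨ i = par₂ j))))

/-- Euclidean distance on `ℝ²` (coordinates `(a,b)`). -/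
def dist2 (x y : ℝ × ℝ) : ℝ := Real.sqrt ((x.1 - y.1)^2 + (x.2 - y.2)^2)

/-- `p` belongs to the configuration space `P`: no collision of adjacent agents. -/
def InConfigSpace {N : ℕ} (G : SimpleGraph (Fin N)) (p : Fin N → ℝ × ℝ) : Prop :=
  ∀ i j, G.Adj i j → p i ≠ p j

/-- `p` is an equilibrium of the RMA system `ẋᵢ = Σ_{j : (i,j) ∈ E} f_ij(d_ij)(x_j − x_i)`. -/
def IsEquilibrium {N : ℕ} (G : SimpleGraph (Fin N)) (f : Fin N → Fin N → ℝ → ℝ)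
    (p : Fin N → ℝ × ℝ) : Prop :=
  ∀ i, (∑ j, if G.Adj i j then (f i j (dist2 (p i) (p j))) • (p j - p i) else (0:ℝ×ℝ)) = 0

/-- The potential function `Φ(p) = Σ_{(i,j) ∈ E} ∫_1^{d_ij} x f_ij(x) dx`
(each edge counted once; the factor 1/2 compensates the double count over ordered pairs). -/
def potential {N : ℕ} (G : SimpleGraph (Fin N)) (f : Fin N → Fin N → ℝ → ℝ)
    (p : Fin N → ℝ × ℝ) : ℝ :=
  (1/2) * ∑ i, ∑ j, if G.Adj i j then ∫ x in (1:ℝ)..(dist2 (p i) (p j)), x * f i j x else 0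

/-- Coordinate directions on the configuration space, in the order `(a₁,…,a_N,b₁,…,b_N)`. -/
def basisVec {N : ℕ} : (Fin N ⊕ Fin N) → (Fin N → ℝ × ℝ) :=
  Sum.elim (fun i => Pi.single i ((1:ℝ), (0:ℝ))) (fun i => Pi.single i ((0:ℝ), (1:ℝ)))

/-- The Hessian matrix of `Φ` at `p` in the coordinates `(a₁,…,a_N,b₁,…,b_N)`. -/
def hessian {N : ℕ} (Φ : (Fin N → ℝ × ℝ) → ℝ) (p : Fin N → ℝ × ℝ) :
    Matrix (Fin N ⊕ Fin N) (Fin N ⊕ Fin N) ℝ :=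
  Matrix.of fun u v => fderiv ℝ (fun q => fderiv ℝ Φ q (basisVec v)) p (basisVec u)

/-- The inertia `𝐧(M) = (n₊(M), n₀(M), n₋(M))` of a real symmetric matrix: the numbers of
positive, zero, and negative eigenvalues (counted with multiplicity). -/
def inertia {m : Type*} [Fintype m] [DecidableEq m] (M : Matrix m m ℝ) : ℕ × ℕ × ℕ :=
  if h : M.IsHermitian then
    ((Finset.univ.filter fun i => 0 < h.eigenvalues i).card,
     (Finset.univ.filter fun i => h.eigenvalues i = 0).card,
     (Finset.univ.filter fun i => h.eigenvalues i < 0).card)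
  else (0, 0, 0)

/-- The number `n₀(M)` of zero eigenvalues of a real symmetric matrix. -/
def n0 {m : Type*} [Fintype m] [DecidableEq m] (M : Matrix m m ℝ) : ℕ := (inertia M).2.1

/-- The vector-valued sign function. -/
def sgn3 (x : ℝ) : ℕ × ℕ × ℕ :=
  if 0 < x then (1,0,0) else if x = 0 then (0,1,0) else (0,0,1)

/-- `q` lies in the `SE(2)`-orbit of `p` (rigid motions: rotation by `(c,s)` with
`c² + s² = 1` followed by translation by `(vx,vy)`). -/
def sameOrbit {N : ℕ} (p q : Fin N → ℝ × ℝ) : Prop :=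
  ∃ c s vx vy : ℝ, c^2 + s^2 = 1 ∧
    ∀ i, q i = (c * (p i).1 - s * (p i).2 + vx, s * (p i).1 + c * (p i).2 + vy)

/-- The interaction laws determined by an ensemble `ω ∈ 𝓕^{|E|}`. -/
def ensembleLaws {N : ℕ} {G : SimpleGraph (Fin N)} (ω : G.edgeSet → FF) :
    Fin N → Fin N → ℝ → ℝ :=
  fun i j => if h : G.Adj i j then (ω ⟨s(i,j), G.mem_edgeSet.mpr h⟩).1.1 else 0

/-- The line configuration on the `a`-axis with coordinates `a`. -/
def lineConfig {N : ℕ} (a : Fin N → ℝ) : Fin N → ℝ × ℝ := fun i => (a i, 0)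

/-- The matrix `F_p` of a line configuration with coordinates `a`: symmetric, zero row sums,
off-diagonal entries `φ_ij(d_ij)` on edges and `0` otherwise. -/
def FMat {N : ℕ} (G : SimpleGraph (Fin N)) (φ : Fin N → Fin N → ℝ → ℝ)
    (a : Fin N → ℝ) : Matrix (Fin N) (Fin N) ℝ :=
  Matrix.of fun i j =>
    if i = j then -∑ k, (if G.Adj i k then φ i k |a i - a k| else 0)
    else if G.Adj i j then φ i j |a i - a j| else 0

/-- The matrix `d̃F_p`: off-diagonal entries `f̃′_ij(d_ij)` on edges. -/
def dFMat {N : ℕ} (G : SimpleGraph (Fin N)) (f : Fin N → Fin N → ℝ → ℝ)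
    (a : Fin N → ℝ) : Matrix (Fin N) (Fin N) ℝ :=
  FMat G (fun i j d => deriv (tildeFn (f i j)) d) a

/-- Case 1 balanced distance: the (generically unique) `d₁₂(d)` with `0 < d₁₂ < d` and
`f̃₁₂(d₁₂) = f̃₁₃(d − d₁₂)`. -/
def case1d12 (f12 f13 : ℝ → ℝ) (d : ℝ) : ℝ :=
  Classical.epsilon fun t => 0 < t ∧ t < d ∧ tildeFn f12 t = tildeFn f13 (d - t)

/-- The case-1 virtual interaction: `g̃₂₃(d) = f̃₁₂(d₁₂(d))`. -/
def g23Case1 (f12 f13 : ℝ → ℝ) : ℝ → ℝ :=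
  fun d => tildeFn f12 (case1d12 f12 f13 d) / d

/-- Case 2 balanced distance: the (generically unique) `d₁₂(d) > 0` with
`f̃₁₂(d₁₂) + f̃₁₃(d₁₂ + d) = 0`. -/
def case2d12 (f12 f13 : ℝ → ℝ) (d : ℝ) : ℝ :=
  Classical.epsilon fun t => 0 < t ∧ tildeFn f12 t + tildeFn f13 (t + d) = 0

/-- The case-2 virtual interaction: `g̃₂₃(d) = f̃₁₃(d₁₃(d))`, `d₁₃(d) = d₁₂(d) + d`. -/
def g23Case2 (f12 f13 : ℝ → ℝ) : ℝ → ℝ :=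
  fun d => tildeFn f13 (case2d12 f12 f13 d + d) / d

/-- The case-3 virtual interaction: case 2 with the roles of agents 2,3 (and `f₁₂`,`f₁₃`)
interchanged. -/
def g23Case3 (f12 f13 : ℝ → ℝ) : ℝ → ℝ := g23Case2 f13 f12

/-- The virtual interaction between agents 2 and 3 induced by `f₁₂`, `f₁₃`, chosen according
to which of the three aligned agents (at coordinates `a1`, `a2`, `a3`) lies between the
other two. -/
def virtualG (f12 f13 : ℝ → ℝ) (a1 a2 a3 : ℝ) : ℝ → ℝ :=
  if (a2 < a1 ∧ a1 < a3) ∨ (a3 < a1 ∧ a1 < a2) then g23Case1 f12 f13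
  else if (a1 < a2 ∧ a2 < a3) ∨ (a3 < a2 ∧ a2 < a1) then g23Case2 f12 f13
  else g23Case3 f12 f13

/-- The interaction laws of the reduced system: vertex `0` (the last Henneberg vertex,
the paper's vertex 1) is deleted, reduced vertex `i` is original vertex `i+1`, and the law on
the reduced edge `(0,1)` (the paper's edge `(2,3)`) is `f*₂₃ = f₂₃ + g₂₃`. -/
def reducedLaws {n : ℕ} (f : Fin (n+3) → Fin (n+3) → ℝ → ℝ) (g : ℝ → ℝ) :
    Fin (n+2) → Fin (n+2) → ℝ → ℝ :=
  fun i j => if (i = 0 ∧ j = 1) ∨ (i = 1 ∧ j = 0)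
    then fun d => f i.succ j.succ d + g d
    else f i.succ j.succ

end

/-! ### Interaction laws -/

namespace MemF

variable {f : ℝ → ℝ}

theorem contDiffAt (hf : MemF f) {d : ℝ} (hd : 0 < d) : ContDiffAt ℝ 1 f d :=
  hf.1.contDiffAt (Ioi_mem_nhds hd)

theorem differentiableAt (hf : MemF f) {d : ℝ} (hd : 0 < d) : DifferentiableAt ℝ f d :=
  (hf.contDiffAt hd).differentiableAt one_ne_zero

theorem hasDerivAt_tildeFn (hf : MemF f) {d : ℝ} (hd : 0 < d) :
    HasDerivAt (tildeFn f) (f d + d * deriv f d) d := by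
  have h := (hasDerivAt_id d).mul (hf.differentiableAt hd).hasDerivAt
  simp only [one_mul, id_eq] at h
  exact h

theorem continuousOn_tildeFn (hf : MemF f) : ContinuousOn (tildeFn f) (Ioi 0) :=
  fun _ hd => (hf.hasDerivAt_tildeFn hd).continuousAt.continuousWithinAt

theorem deriv_tildeFn_pos (hf : MemF f) {d : ℝ} (hd : 0 < d) : 0 < f d + d * deriv f d := by
  rw [← (hf.hasDerivAt_tildeFn hd).deriv]
  exact hf.2.1 d hd

theorem strictMonoOn_tildeFn (hf : MemF f) : StrictMonoOn (tildeFn f) (Ioi 0) :=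
  strictMonoOn_of_deriv_pos (convex_Ioi 0) hf.continuousOn_tildeFn fun x hx =>
    hf.2.1 x (by simpa using hx)

theorem intervalIntegrable_tildeFn (hf : MemF f) {a b : ℝ} (ha : 0 < a) (hb : 0 < b) :
    IntervalIntegrable (tildeFn f) volume a b :=
  (hf.continuousOn_tildeFn.mono fun x hx => by
    rw [mem_uIcc] at hx
    rcases hx with h | h
    · exact ha.trans_le h.1
    · exact hb.trans_le h.1).intervalIntegrable

/-- An interaction law is infinitely repulsive at short distances. -/
theorem exists_lt_tildeFn_lt (hf : MemF f) (K : ℝ) {c : ℝ} (hc : 0 < c) :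
    ∃ a, 0 < a ∧ a < c ∧ ∀ x, 0 < x → x < a → tildeFn f x < K := by
  by_contra! h
  have hge : ∀ y, 0 < y → K ≤ tildeFn f y := by
    intro y hy
    obtain ⟨x, hx0, hxa, hK⟩ := h (min (c / 2) y) (lt_min (by linarith) hy)
      ((min_le_left _ _).trans_lt (by linarith))
    have hxy : x < y := hxa.trans_le (min_le_right _ _)
    exact hK.trans (hf.strictMonoOn_tildeFn hx0 hy hxy).le
  have hev : ∀ᶠ d in 𝓝[>] (0 : ℝ), -|K| ≤ ∫ x in d..(1 : ℝ), tildeFn f x := by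
    filter_upwards [Ioo_mem_nhdsGT (zero_lt_one : (0 : ℝ) < 1)] with d hd
    have h1 : ∫ x in d..(1 : ℝ), K ≤ ∫ x in d..(1 : ℝ), tildeFn f x :=
      intervalIntegral.integral_mono_on hd.2.le intervalIntegrable_const
        (hf.intervalIntegrable_tildeFn hd.1 one_pos) fun x hx => hge x (hd.1.trans_le hx.1)
    rw [intervalIntegral.integral_const, smul_eq_mul] at h1
    have h2 : -|K| ≤ (1 - d) * K := by
      have := neg_abs_le K
      have := abs_nonneg K
      nlinarith [hd.1, hd.2, le_abs_self K]
    exact h2.trans h1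
  obtain ⟨d, hd1, hd2⟩ := (hev.and (hf.2.2.2.eventually (eventually_lt_atBot (-|K|)))).exists
  exact absurd hd1 (not_le.mpr hd2)

/-- Uniform confinement of a distance from an upper bound on its virtual work, for all laws
uniformly close to `f`. -/
theorem exists_Icc_of_mul_le (hf : MemF f) {D η : ℝ} (hD : 0 < D)
    (hη : η ≤ tildeFn f D / 2) (hs : 0 < tildeFn f D) (M : ℝ) :
    ∃ a b, 0 < a ∧ ∀ r x, 0 < x → |r| ≤ η → (tildeFn f x + r) * (x - D) ≤ M → a ≤ x ∧ x ≤ b := by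
  set s := tildeFn f D with hsdef
  obtain ⟨a, ha, haD, hblow⟩ := hf.exists_lt_tildeFn_lt (-(2 * |M| / D + s + 1)) (half_pos hD)
  refine ⟨a, D + 2 * |M| / s, ha, fun r x hx hr hM => ⟨?_, ?_⟩⟩
  · by_contra! hxa
    have h1 := hblow x hx hxa
    have h2 : tildeFn f x + r < -(2 * |M| / D) - 1 := by linarith [(abs_le.mp hr).2]
    have h3 : 2 * |M| / D * (D / 2) = |M| := by field_simp
    have h4 : 0 ≤ 2 * |M| / D := by positivity
    nlinarith [le_abs_self M]
  · by_contra! hxb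
    have h0 : 0 ≤ 2 * |M| / s := by positivity
    have h1 : s ≤ tildeFn f x := (hf.strictMonoOn_tildeFn hD hx (by linarith)).le
    have h2 : s / 2 ≤ tildeFn f x + r := by linarith [(abs_le.mp hr).1]
    have h3 : s / 2 * (2 * |M| / s) = |M| := by field_simp
    nlinarith [le_abs_self M]

theorem neg_le_mul_sub (hf : MemF f) {D η : ℝ} (hD : 0 < D)
    (hη : η ≤ tildeFn f D / 2) (hs : 0 < tildeFn f D) {r x : ℝ} (hx : 0 < x) (hr : |r| ≤ η) :
    -(2 * tildeFn f D * D) ≤ (tildeFn f x + r) * (x - D) := by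
  set s := tildeFn f D with hsdef
  have hr' := abs_le.mp hr
  rcases le_total x D with h | h
  · have h1 : tildeFn f x ≤ s := hf.strictMonoOn_tildeFn.monotoneOn hx hD h
    have h2 : tildeFn f x + r ≤ 2 * s := by linarith
    nlinarith
  · have h1 : s ≤ tildeFn f x := hf.strictMonoOn_tildeFn.monotoneOn hD hx h
    have h2 : 0 ≤ (tildeFn f x + r) * (x - D) := mul_nonneg (by linarith) (by linarith)
    nlinarith

end MemF

/-! ### Constrained balance of tensions -/

/-- `d` is a vector of edge lengths in the subspace `S` at which the tensions `f̃_e(d_e)` do no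
virtual work along `S`. -/
def IsBalanced {E : Type*} [Fintype E] (ω : E → FF) (S : Submodule ℝ (E → ℝ)) (d : E → ℝ) : Prop :=
  (∀ e, 0 < d e) ∧ d ∈ S ∧ ∀ v ∈ S, ∑ e, tildeFn (ω e).1.1 (d e) * v e = 0

section Balanced

variable {E : Type*} [Fintype E] {ω : E → FF} {S : Submodule ℝ (E → ℝ)}

theorem IsBalanced.eq {d d' : E → ℝ} (h : IsBalanced ω S d) (h' : IsBalanced ω S d') : d = d' := by
  have hmono : ∀ e, 0 ≤ (tildeFn (ω e).1.1 (d e) - tildeFn (ω e).1.1 (d' e)) * (d e - d' e) := by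
    intro e
    rcases le_total (d e) (d' e) with hle | hle
    · have := (ω e).2.strictMonoOn_tildeFn.monotoneOn (h.1 e) (h'.1 e) hle
      nlinarith
    · have := (ω e).2.strictMonoOn_tildeFn.monotoneOn (h'.1 e) (h.1 e) hle
      nlinarith
  have hsum : ∑ e, (tildeFn (ω e).1.1 (d e) - tildeFn (ω e).1.1 (d' e)) * (d e - d' e) = 0 := by
    have h1 := h.2.2 _ (S.sub_mem h.2.1 h'.2.1)
    have h2 := h'.2.2 _ (S.sub_mem h.2.1 h'.2.1)
    simp only [Pi.sub_apply] at h1 h2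
    simp only [sub_mul, Finset.sum_sub_distrib, h1, h2, sub_self]
  funext e
  have he := (Finset.sum_eq_zero_iff_of_nonneg fun e _ => hmono e).mp hsum e (Finset.mem_univ e)
  rcases lt_trichotomy (d e) (d' e) with hlt | heq | hlt
  · have := (ω e).2.strictMonoOn_tildeFn (h.1 e) (h'.1 e) hlt
    nlinarith
  · exact heq
  · have := (ω e).2.strictMonoOn_tildeFn (h'.1 e) (h.1 e) hlt
    nlinarith

theorem isOpen_setOf_near (ω : E → FF) {η : ℝ} (hη : 0 < η) :
    ∃ V : Set (E → FF), IsOpen V ∧ ω ∈ V ∧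
      ∀ ω' ∈ V, ∀ e x, 0 < x → |tildeFn (ω' e).1.1 x - tildeFn (ω e).1.1 x| < η := by
  refine ⟨⋂ e, (fun ω' : E → FF => (ω' e).1) ⁻¹' { g : C1Pos | ∀ d > (0 : ℝ),
    |g.1 d - (ω e).1.1 d| + |deriv g.1 d - deriv (ω e).1.1 d| < η / d }, ?_, ?_, ?_⟩
  · refine isOpen_iInter_of_finite fun e => ?_
    refine IsOpen.preimage (continuous_subtype_val.comp (continuous_apply e)) ?_
    refine TopologicalSpace.isOpen_generateFrom_of_mem ⟨(ω e).1, fun d => η / d, ?_, ?_, rfl⟩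
    · exact continuousOn_const.div continuousOn_id fun x hx => ne_of_gt hx
    · exact fun d hd => div_pos hη hd
  · simp only [mem_iInter, mem_preimage, mem_ofPred_eq, sub_self, abs_zero, add_zero]
    exact fun e d hd => div_pos hη hd
  · intro ω' hω' e x hx
    have h := mem_iInter.mp hω' e x hx
    have h1 : |(ω' e).1.1 x - (ω e).1.1 x| < η / x :=
      (le_add_of_nonneg_right (abs_nonneg _)).trans_lt h
    rw [lt_div_iff₀ hx] at h1
    have h2 : tildeFn (ω' e).1.1 x - tildeFn (ω e).1.1 x
        = x * ((ω' e).1.1 x - (ω e).1.1 x) := by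
      simp only [tildeFn]; ring
    rw [h2, abs_mul, abs_of_pos hx, mul_comm]
    exact h1

/-- Balanced lengths stay in a fixed compact box for all ensembles near a given one. -/
theorem exists_box (ω : E → FF) (S : Submodule ℝ (E → ℝ)) :
    ∃ η > 0, ∃ a b : E → ℝ, (∀ e, 0 < a e) ∧ ∀ ω' : E → FF,
      (∀ e x, 0 < x → |tildeFn (ω' e).1.1 x - tildeFn (ω e).1.1 x| < η) →
      ∀ d, IsBalanced ω' S d → ∀ e, a e ≤ d e ∧ d e ≤ b e := by
  by_cases hS : ∃ D₀ ∈ S, ∀ e, 0 < D₀ e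
  swap
  · exact ⟨1, one_pos, 1, 1, fun e => one_pos, fun ω' _ d hd => (hS ⟨d, hd.2.1, hd.1⟩).elim⟩
  obtain ⟨D₀, hD₀S, hD₀⟩ := hS
  choose z hz hz0 using fun e => (ω e).2.2.2.1
  obtain ⟨c, hc⟩ : ∃ c : ℝ, ∀ e, z e / D₀ e < c :=
    (Filter.eventually_all.mpr fun e => eventually_gt_atTop (z e / D₀ e)).exists
  set D : E → ℝ := c • D₀ with hDdef
  have hDS : D ∈ S := S.smul_mem c hD₀S
  have hzD : ∀ e, z e < D e := fun e => (div_lt_iff₀ (hD₀ e)).mp (hc e)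
  have hD : ∀ e, 0 < D e := fun e => (hz e).trans (hzD e)
  have hs : ∀ e, 0 < tildeFn (ω e).1.1 (D e) := fun e => by
    have := (ω e).2.strictMonoOn_tildeFn (hz e) (hD e) (hzD e)
    rwa [hz0 e] at this
  obtain ⟨η, hη, hηpos⟩ : ∃ η : ℝ, (∀ e, η < tildeFn (ω e).1.1 (D e) / 2) ∧ 0 < η :=
    ((Filter.eventually_all.mpr fun e => mem_of_superset
      (Ioo_mem_nhdsGT (half_pos (hs e))) fun x hx => hx.2).and self_mem_nhdsWithin).exists
  choose a b ha hab using fun e => (ω e).2.exists_Icc_of_mul_le (hD e) (hη e).le (hs e)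
    (∑ e, 2 * tildeFn (ω e).1.1 (D e) * D e)
  refine ⟨η, hηpos, a, b, ha, fun ω' hω' d hd e => ?_⟩
  refine hab e (tildeFn (ω' e).1.1 (d e) - tildeFn (ω e).1.1 (d e)) (d e) (hd.1 e)
    (hω' e _ (hd.1 e)).le ?_
  have hnn : ∀ e, 0 ≤ tildeFn (ω' e).1.1 (d e) * (d e - D e)
      + 2 * tildeFn (ω e).1.1 (D e) * D e := by
    intro e
    have := (ω e).2.neg_le_mul_sub (hD e) (hη e).le (hs e) (hd.1 e) (hω' e _ (hd.1 e)).le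
    rw [add_sub_cancel] at this
    linarith
  have hsum := hd.2.2 _ (S.sub_mem hd.2.1 hDS)
  have hle := Finset.single_le_sum (fun e _ => hnn e) (Finset.mem_univ e)
  simp only [Pi.sub_apply] at hsum
  rw [Finset.sum_add_distrib, hsum, zero_add] at hle
  rw [add_sub_cancel]
  linarith [mul_pos (mul_pos two_pos (hs e)) (hD e)]

theorem isOpen_setOf_forall_isBalanced_ne_zero (S : Submodule ℝ (E → ℝ)) (φ : (E → ℝ) →ₗ[ℝ] ℝ) :
    IsOpen {ω : E → FF | ∀ d, IsBalanced ω S d → φ d ≠ 0} := by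
  refine isOpen_iff_forall_mem_open.mpr fun ω hω => ?_
  obtain ⟨η, hη, a, b, ha, hbox⟩ := exists_box ω S
  let W : Submodule ℝ (E → ℝ) :=
    { carrier := {t | ∀ v ∈ S, ∑ e, t e * v e = 0}
      add_mem' := fun {t u} ht hu v hv => by
        simp only [Pi.add_apply, add_mul, Finset.sum_add_distrib, ht v hv, hu v hv, add_zero]
      zero_mem' := fun v _ => by simp
      smul_mem' := fun c t ht v hv => by
        simp only [Pi.smul_apply, smul_eq_mul, mul_assoc, ← Finset.mul_sum, ht v hv, mul_zero] }
  have hW : IsClosed (W : Set (E → ℝ)) := W.closed_of_finiteDimensional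
  let K : Set (E → ℝ) := (univ.pi fun e => Icc (a e) (b e)) ∩ (S ∩ LinearMap.ker φ)
  have hK : IsCompact K := (isCompact_univ_pi fun e => isCompact_Icc).inter_right
    (S.closed_of_finiteDimensional.inter (LinearMap.ker φ).closed_of_finiteDimensional)
  have hKpos : ∀ d ∈ K, ∀ e, 0 < d e := fun d hd e => (ha e).trans_le (hd.1 e trivial).1
  have hcont : ContinuousOn
      (fun d => Metric.infDist (fun e => tildeFn (ω e).1.1 (d e)) (W : Set (E → ℝ))) K := by
    refine (Metric.continuous_infDist_pt _).comp_continuousOn (continuousOn_pi.mpr fun e => ?_)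
    exact (ω e).2.continuousOn_tildeFn.comp (continuous_apply e).continuousOn
      fun d hd => hKpos d hd e
  obtain ⟨η₁, hη₁, hmin⟩ := hK.exists_forall_le' hcont (a := 0) fun d hd => by
    refine (hW.notMem_iff_infDist_pos ⟨0, W.zero_mem⟩).mp fun hmem => ?_
    exact hω d ⟨hKpos d hd, hd.2.1, hmem⟩ hd.2.2
  obtain ⟨V, hVo, hωV, hV⟩ := isOpen_setOf_near ω (lt_min hη hη₁)
  refine ⟨V, fun ω' hω' d hd h0 => ?_, hVo, hωV⟩
  have hdK : d ∈ K := ⟨fun e _ => hbox ω' (fun e x hx =>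
    (hV ω' hω' e x hx).trans_le (min_le_left _ _)) d hd e, hd.2.1, h0⟩
  have h1 : Metric.infDist (fun e => tildeFn (ω e).1.1 (d e)) (W : Set (E → ℝ))
      ≤ dist (fun e => tildeFn (ω e).1.1 (d e)) (fun e => tildeFn (ω' e).1.1 (d e)) :=
    Metric.infDist_le_dist_of_mem (show _ ∈ W from hd.2.2)
  have h2 : dist (fun e => tildeFn (ω e).1.1 (d e)) (fun e => tildeFn (ω' e).1.1 (d e)) < η₁ := by
    refine (dist_pi_lt_iff hη₁).mpr fun e => ?_
    rw [dist_comm, Real.dist_eq]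
    exact (hV ω' hω' e _ (hd.1 e)).trans_le (min_le_right _ _)
  exact absurd (hmin d hdK) (not_le.mpr (h1.trans_lt h2))

end Balanced

/-! ### Local perturbations of an interaction law -/

/-- A law `f` can be perturbed within `𝓕`, continuously in the Whitney topology, so that `f̃` is
shifted by a constant near a given distance. -/
theorem FF.exists_local_shift (f : FF) {x₀ : ℝ} (hx₀ : 0 < x₀) :
    ∃ γ : ℝ → FF, Tendsto γ (𝓝 0) (𝓝 f) ∧ ∃ r > 0, ∀ᶠ τ in 𝓝 (0 : ℝ), ∀ x, |x - x₀| < r →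
      tildeFn (γ τ).1.1 x = tildeFn f.1.1 x + τ := by
  obtain ⟨F, hf⟩ := f
  set f : ℝ → ℝ := F.1 with hfdef
  have hfC : ContDiffOn ℝ 1 f (Ioi 0) := F.2
  let ψ : ContDiffBump x₀ := ⟨x₀ / 4, x₀ / 2, by linarith, by linarith⟩
  have hψ : ContDiff ℝ 1 ψ := ψ.contDiff
  have hψ0 : ∀ x, x₀ / 2 ≤ |x - x₀| → ψ x = 0 := fun x hx =>
    ψ.zero_of_le_dist (by rw [Real.dist_eq]; exact hx)
  have hψ1 : ∀ x, |x - x₀| ≤ x₀ / 4 → ψ x = 1 := fun x hx =>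
    ψ.one_of_mem_closedBall (by rw [Metric.mem_closedBall, Real.dist_eq]; exact hx)
  set I : Set ℝ := Icc (x₀ / 2) (3 * x₀ / 2) with hI
  have hIc : IsCompact I := isCompact_Icc
  have hIpos : I ⊆ Ioi 0 := fun x hx => (half_pos hx₀).trans_le hx.1
  have hψI : ∀ x, x ∉ I → ψ x = 0 := by
    intro x hx
    refine hψ0 x ?_
    by_contra! h
    rw [abs_lt] at h
    exact hx ⟨by linarith, by linarith⟩
  have hdψI : ∀ x, x ∉ I → deriv ψ x = 0 := by
    intro x hx
    have : ψ =ᶠ[𝓝 x] fun _ => (0 : ℝ) := by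
      filter_upwards [hIc.isClosed.isOpen_compl.mem_nhds hx] with y hy using hψI y hy
    rw [this.deriv_eq, deriv_const]
  let κ : ℝ → ℝ := fun x => ψ x / x
  have hκ : ContDiffOn ℝ 1 κ (Ioi 0) :=
    hψ.contDiffOn.div contDiffOn_id fun x hx => ne_of_gt hx
  have hκI : ∀ x, x ∉ I → κ x = 0 := fun x hx => by simp only [κ, hψI x hx, zero_div]
  have hdκI : ∀ x, x ∉ I → deriv κ x = 0 := by
    intro x hx
    have : κ =ᶠ[𝓝 x] fun _ => (0 : ℝ) := by
      filter_upwards [hIc.isClosed.isOpen_compl.mem_nhds hx] with y hy using hκI y hy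
    rw [this.deriv_eq, deriv_const]
  have hC : ∀ τ : ℝ, ContDiffOn ℝ 1 (fun x => f x + τ * κ x) (Ioi 0) := fun τ =>
    hfC.add (contDiffOn_const.mul hκ)
  have hdκ : ∀ x, 0 < x → DifferentiableAt ℝ κ x := fun x hx =>
    (hκ.contDiffAt (Ioi_mem_nhds hx)).differentiableAt one_ne_zero
  have hd : ∀ (τ x : ℝ), 0 < x → deriv (fun x => f x + τ * κ x) x = deriv f x + τ * deriv κ x := by
    intro τ x hx
    exact ((hf.differentiableAt hx).hasDerivAt.add
      ((hdκ x hx).hasDerivAt.const_mul τ)).deriv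
  have htilde : ∀ (τ x : ℝ), tildeFn (fun x => f x + τ * κ x) x = tildeFn f x + τ * ψ x := by
    intro τ x
    rcases eq_or_ne x 0 with rfl | hx
    · have : ψ 0 = 0 := hψI 0 fun h => absurd h.1 (not_le.mpr (half_pos hx₀))
      simp [tildeFn, this]
    · simp only [tildeFn, κ]
      field_simp
  have hdc : ∀ g : ℝ → ℝ, ContDiffOn ℝ 1 g (Ioi 0) → ContinuousOn (deriv g) (Ioi 0) := fun g hg =>
    hg.continuousOn_deriv_of_isOpen isOpen_Ioi le_rfl
  have hsmall : ∀ C m : ℝ, 0 < m → ∀ᶠ τ in 𝓝 (0 : ℝ), |τ| * C < m := by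
    intro C m hm
    have : Tendsto (fun τ : ℝ => |τ| * C) (𝓝 0) (𝓝 (|(0 : ℝ)| * C)) :=
      (continuous_abs.mul continuous_const).tendsto 0
    rw [abs_zero, zero_mul] at this
    exact this.eventually (gt_mem_nhds hm)
  have hmem : ∀ᶠ τ in 𝓝 (0 : ℝ), MemF (fun x => f x + τ * κ x) := by
    obtain ⟨C, hCb⟩ := hIc.exists_bound_of_continuousOn (hψ.continuous_deriv le_rfl).continuousOn
    obtain ⟨m, hm, hmb⟩ := hIc.exists_forall_le' (f := fun x => f x + x * deriv f x) (a := 0)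
      ((hfC.continuousOn.add (continuousOn_id.mul (hdc f hfC))).mono hIpos)
      fun x hx => hf.deriv_tildeFn_pos (hIpos hx)
    filter_upwards [hsmall C m hm] with τ hτ
    have htfun : tildeFn (fun x => f x + τ * κ x) = fun x => tildeFn f x + τ * ψ x :=
      funext (htilde τ)
    have hτψ : Continuous fun x => τ * ψ x := continuous_const.mul hψ.continuous
    have hψd : Differentiable ℝ ψ := hψ.differentiable one_ne_zero
    refine ⟨hC τ, fun x hx => ?_, ?_, ?_⟩
    · rw [htfun]
      have hder : deriv (fun x => tildeFn f x + τ * ψ x) x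
          = (f x + x * deriv f x) + τ * deriv ψ x :=
        ((hf.hasDerivAt_tildeFn hx).add ((hψd x).hasDerivAt.const_mul τ)).deriv
      rw [hder]
      by_cases hxI : x ∈ I
      · have h1 := hmb x hxI
        have h2 := hCb x hxI
        rw [Real.norm_eq_abs] at h2
        have h3 : |τ * deriv ψ x| ≤ |τ| * C := by
          rw [abs_mul]; exact mul_le_mul_of_nonneg_left h2 (abs_nonneg _)
        linarith [neg_abs_le (τ * deriv ψ x)]
      · rw [hdψI x hxI, mul_zero, add_zero]
        exact hf.deriv_tildeFn_pos hx
    · rw [htfun]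
      obtain ⟨a, ha, hax, hblow⟩ := hf.exists_lt_tildeFn_lt 0 (half_pos hx₀)
      obtain ⟨z, hz, hz0⟩ := hf.2.2.1
      set y := max z (3 * x₀ / 2) + 1 with hy
      have hzy : z < y := (le_max_left _ _).trans_lt (lt_add_one _)
      have hxy : 3 * x₀ / 2 < y := (le_max_right _ _).trans_lt (lt_add_one _)
      have hl : tildeFn f (a / 2) + τ * ψ (a / 2) ≤ 0 := by
        rw [hψI _ fun h => absurd h.1 (by linarith), mul_zero, add_zero]
        exact (hblow _ (half_pos ha) (half_lt_self ha)).le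
      have hr : 0 ≤ tildeFn f y + τ * ψ y := by
        rw [hψI _ fun h => absurd h.2 (by linarith), mul_zero, add_zero, ← hz0]
        exact (hf.strictMonoOn_tildeFn hz (hz.trans hzy) hzy).le
      have hco : ContinuousOn (fun x => tildeFn f x + τ * ψ x) (Icc (a / 2) y) :=
        (hf.continuousOn_tildeFn.mono fun x hx => (half_pos ha).trans_le hx.1).add
          (continuous_const.mul hψ.continuous).continuousOn
      obtain ⟨t, ht, ht0⟩ := intermediate_value_Icc (by linarith) hco ⟨hl, hr⟩
      exact ⟨t, (half_pos ha).trans_le ht.1, ht0⟩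
    · rw [htfun]
      have hb : ∀ᶠ d in 𝓝[>] (0 : ℝ), τ * ∫ x in d..(1 : ℝ), ψ x ≤ |τ| := by
        filter_upwards [Ioo_mem_nhdsGT (zero_lt_one : (0 : ℝ) < 1)] with d hd
        have h1 : ‖∫ x in d..(1 : ℝ), ψ x‖ ≤ 1 * |1 - d| :=
          intervalIntegral.norm_integral_le_of_norm_le_const fun x _ => by
            rw [Real.norm_of_nonneg ψ.nonneg]; exact ψ.le_one
        have h2 : |1 - d| ≤ 1 := abs_le.mpr ⟨by linarith [hd.2], by linarith [hd.1]⟩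
        calc τ * ∫ x in d..(1 : ℝ), ψ x ≤ |τ * ∫ x in d..(1 : ℝ), ψ x| := le_abs_self _
          _ = |τ| * |∫ x in d..(1 : ℝ), ψ x| := abs_mul _ _
          _ ≤ |τ| * 1 := mul_le_mul_of_nonneg_left
              (by rw [Real.norm_eq_abs] at h1; linarith) (abs_nonneg _)
          _ = |τ| := mul_one _
      refine (Filter.tendsto_atBot_add_right_of_ge' _ _ hf.2.2.2 hb).congr' ?_
      filter_upwards [self_mem_nhdsWithin] with d hd
      rw [← intervalIntegral.integral_const_mul, eq_comm, intervalIntegral.integral_add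
        (hf.intervalIntegrable_tildeFn hd one_pos)
        (hτψ.intervalIntegrable _ _)]
  let c : ℝ → C1Pos := fun τ => ⟨_, hC τ⟩
  let γ : ℝ → FF := fun τ => if h : MemF (c τ).1 then ⟨c τ, h⟩ else ⟨F, hf⟩
  have hγ : ∀ τ, MemF (c τ).1 → (γ τ).1 = c τ := fun τ h =>
    congrArg (fun g : FF => g.1) (dif_pos h)
  refine ⟨γ, ?_, x₀ / 4, by linarith, ?_⟩
  · have hC1 : Tendsto c (𝓝 0) (𝓝 F) := by
      refine TopologicalSpace.tendsto_nhds_generateFrom_iff.mpr ?_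
      rintro _ ⟨g, δ, hδc, hδ, rfl⟩ hfg
      obtain ⟨C, hCb⟩ := hIc.exists_bound_of_continuousOn
        ((hκ.continuousOn.abs.add (hdc κ hκ).abs).mono hIpos)
      obtain ⟨m, hm, hmb⟩ := hIc.exists_forall_le' (a := 0)
        (f := fun x => δ x - (|f x - g.1 x| + |deriv f x - deriv g.1 x|))
        ((hδc.sub ((hfC.continuousOn.sub g.2.continuousOn).abs.add
          ((hdc f hfC).sub (hdc g.1 g.2)).abs)).mono hIpos)
        fun x hx => sub_pos.mpr (hfg x (hIpos hx))
      filter_upwards [hsmall C m hm] with τ hτ x hx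
      change |f x + τ * κ x - g.1 x| + |deriv (fun x => f x + τ * κ x) x - deriv g.1 x| < δ x
      rw [hd τ x hx]
      by_cases hxI : x ∈ I
      · have h1 := hmb x hxI
        have h2 : |κ x| + |deriv κ x| ≤ C := (le_abs_self _).trans (hCb x hxI)
        have h3 : |τ| * (|κ x| + |deriv κ x|) ≤ |τ| * C :=
          mul_le_mul_of_nonneg_left h2 (abs_nonneg _)
        have h4 : |f x + τ * κ x - g.1 x| ≤ |f x - g.1 x| + |τ| * |κ x| := by
          rw [← abs_mul, add_sub_right_comm]; exact abs_add_le _ _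
        have h5 : |deriv f x + τ * deriv κ x - deriv g.1 x|
            ≤ |deriv f x - deriv g.1 x| + |τ| * |deriv κ x| := by
          rw [← abs_mul, add_sub_right_comm]; exact abs_add_le _ _
        linarith
      · rw [hκI x hxI, hdκI x hxI, mul_zero, add_zero, add_zero]
        exact hfg x hx
    refine tendsto_subtype_rng.mpr (hC1.congr' ?_)
    filter_upwards [hmem] with τ hτ using (hγ τ hτ).symm
  · filter_upwards [hmem] with τ hτ x hx
    rw [hγ τ hτ]
    change tildeFn (fun x => f x + τ * κ x) x = tildeFn f x + τ
    rw [htilde, hψ1 x hx.le, mul_one]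

theorem dense_setOf_forall_isBalanced_ne_zero {E : Type*} [Fintype E] (S : Submodule ℝ (E → ℝ))
    (φ : (E → ℝ) →ₗ[ℝ] ℝ) (hφ : ∃ v ∈ S, φ v ≠ 0) :
    Dense {ω : E → FF | ∀ d, IsBalanced ω S d → φ d ≠ 0} := by
  intro ω
  by_cases hgood : ∀ d, IsBalanced ω S d → φ d ≠ 0
  · exact subset_closure hgood
  push Not at hgood
  obtain ⟨d, hd, hd0⟩ := hgood
  obtain ⟨v, hvS, hv⟩ := hφ
  choose γ hγ r hr hshift using fun e => (ω e).exists_local_shift (hd.1 e)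
  let d' : ℝ → E → ℝ := fun s e => d e + s * v e
  have hd'c : ∀ e, Tendsto (fun s => d' s e) (𝓝 0) (𝓝 (d e)) := fun e => by
    have : Continuous fun s : ℝ => d e + s * v e := by fun_prop
    have h := this.tendsto 0
    rwa [zero_mul, add_zero] at h
  let τ : E → ℝ → ℝ := fun e s => tildeFn (ω e).1.1 (d e) - tildeFn (ω e).1.1 (d' s e)
  have hτ : ∀ e, Tendsto (τ e) (𝓝 0) (𝓝 0) := fun e => by
    have h := ((ω e).2.continuousOn_tildeFn.continuousAt (Ioi_mem_nhds (hd.1 e))).tendsto.comp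
      (hd'c e)
    have h2 := (tendsto_const_nhds (x := tildeFn (ω e).1.1 (d e))).sub h
    rwa [sub_self] at h2
  have hlim : Tendsto (fun s e => γ e (τ e s)) (𝓝[≠] 0) (𝓝 ω) :=
    tendsto_nhdsWithin_of_tendsto_nhds
      (tendsto_pi_nhds.mpr fun e => (hγ e).comp (hτ e))
  refine mem_closure_of_tendsto hlim ?_
  have h1 : ∀ᶠ s in 𝓝[≠] (0 : ℝ), ∀ e, tildeFn (γ e (τ e s)).1.1 (d' s e)
      = tildeFn (ω e).1.1 (d e) := by
    refine Filter.eventually_all.mpr fun e => nhdsWithin_le_nhds ?_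
    filter_upwards [(hτ e).eventually (hshift e),
      (hd'c e).eventually (Metric.ball_mem_nhds _ (hr e))] with s hs1 hs2
    rw [hs1 _ (by rwa [← Real.dist_eq])]
    simp only [τ, add_sub_cancel]
  have h2 : ∀ᶠ s in 𝓝[≠] (0 : ℝ), ∀ e, 0 < d' s e :=
    Filter.eventually_all.mpr fun e =>
      nhdsWithin_le_nhds ((hd'c e).eventually (lt_mem_nhds (hd.1 e)))
  filter_upwards [h1, h2, self_mem_nhdsWithin] with s hs1 hs2 hs0 d'' hd''
  have hd's : d' s = d + s • v := rfl
  have hbal : IsBalanced (fun e => γ e (τ e s)) S (d' s) := by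
    refine ⟨hs2, ?_, fun u hu => ?_⟩
    · rw [hd's]
      exact S.add_mem hd.2.1 (S.smul_mem s hvS)
    · simp only [hs1]
      exact hd.2.2 u hu
  rw [hd''.eq hbal, hd's, map_add, map_smul, hd0, zero_add, smul_eq_mul]
  exact mul_ne_zero hs0 hv

theorem exists_isOpen_dense_of_finite {X ι : Type*} [TopologicalSpace X] [Finite ι]
    {U : ι → Set X} (ho : ∀ i, IsOpen (U i)) (hd : ∀ i, Dense (U i)) :
    IsOpen (⋂ i, U i) ∧ Dense (⋂ i, U i) := by
  have key : ∀ s : Set ι, s.Finite → IsOpen (⋂ i ∈ s, U i) ∧ Dense (⋂ i ∈ s, U i) := by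
    intro s hs
    induction s, hs using Set.Finite.induction_on with
    | empty => simp
    | insert _ _ ih =>
      rw [biInter_insert]
      exact ⟨(ho _).inter ih.1, (hd _).inter_of_isOpen_left ih.2 (ho _)⟩
  simpa using key univ finite_univ

/-! ### Planar geometry -/

/-- The Euclidean inner product on `ℝ²`. -/
def dotp (x y : ℝ × ℝ) : ℝ := x.1 * y.1 + x.2 * y.2

/-- The planar cross product. -/
def crs (x y : ℝ × ℝ) : ℝ := x.1 * y.2 - x.2 * y.1

/-- The sign `±1` encoded by a Boolean. -/
def boolSign (b : Bool) : ℝ := if b then 1 else -1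

theorem dist2_comm (x y : ℝ × ℝ) : dist2 x y = dist2 y x := by
  simp only [dist2]; congr 1; ring

theorem dist2_sq (x y : ℝ × ℝ) : dist2 x y ^ 2 = dotp (x - y) (x - y) := by
  rw [dist2, Real.sq_sqrt (by positivity)]
  simp only [dotp, Prod.fst_sub, Prod.snd_sub]; ring

theorem dotp_self_pos {x : ℝ × ℝ} (hx : x ≠ 0) : 0 < dotp x x := by
  have h : x.1 ≠ 0 ∨ x.2 ≠ 0 := by
    by_contra! h
    exact hx (Prod.ext h.1 h.2)
  simp only [dotp]
  rcases h with h | h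
  · have := mul_self_pos.mpr h
    nlinarith [mul_self_nonneg x.2]
  · have := mul_self_pos.mpr h
    nlinarith [mul_self_nonneg x.1]

theorem dist2_pos {x y : ℝ × ℝ} (h : x ≠ y) : 0 < dist2 x y := by
  have h1 := dotp_self_pos (sub_ne_zero.mpr h)
  rw [← dist2_sq] at h1
  refine lt_of_le_of_ne (Real.sqrt_nonneg _) fun h0 => ?_
  change 0 = dist2 x y at h0
  rw [← h0] at h1
  simp at h1

theorem boolSign_decide_pos_mul_abs (r : ℝ) : boolSign (decide (0 < r)) * |r| = r := by
  unfold boolSign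
  split_ifs with h
  · rw [one_mul, abs_of_pos (of_decide_eq_true h)]
  · rw [abs_of_nonpos (not_lt.mp fun hr => h (decide_eq_true hr))]
    ring

theorem exists_linear_solution {a b c d : ℝ} (h : a * d - b * c ≠ 0) (r s : ℝ) :
    ∃ u : ℝ × ℝ, a * u.1 + b * u.2 = r ∧ c * u.1 + d * u.2 = s := by
  refine ⟨((r * d - b * s) / (a * d - b * c), (a * s - r * c) / (a * d - b * c)), ?_, ?_⟩
  · rw [mul_div_assoc', mul_div_assoc', ← add_div, div_eq_iff h]; ring
  · rw [mul_div_assoc', mul_div_assoc', ← add_div, div_eq_iff h]; ring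

theorem eq_zero_of_linear {a b c d : ℝ} (h : a * d - b * c ≠ 0) {u : ℝ × ℝ}
    (h1 : a * u.1 + b * u.2 = 0) (h2 : c * u.1 + d * u.2 = 0) : u = 0 := by
  have e1 : (a * d - b * c) * u.1 = 0 := by linear_combination d * h1 - b * h2
  have e2 : (a * d - b * c) * u.2 = 0 := by linear_combination a * h2 - c * h1
  exact Prod.ext ((mul_eq_zero.mp e1).resolve_left h) ((mul_eq_zero.mp e2).resolve_left h)

/-- Three distinct aligned points `x, y, z`: `x - y` is a multiple of `z - y`. -/
theorem exists_smul_of_crs_eq_zero {D X : ℝ × ℝ} (hD : D ≠ 0) (hX : X ≠ 0) (hXD : X ≠ D)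
    (h : crs D X = 0) : ∃ ρ : ℝ, ρ ≠ 0 ∧ ρ ≠ 1 ∧ X = ρ • D := by
  have hDD := dotp_self_pos hD
  refine ⟨dotp X D / dotp D D, ?_⟩
  have key : X = (dotp X D / dotp D D) • D := by
    simp only [crs] at h
    ext
    · simp only [Prod.smul_fst, smul_eq_mul]
      field_simp
      simp only [dotp]; linear_combination -D.2 * h
    · simp only [Prod.smul_snd, smul_eq_mul]
      field_simp
      simp only [dotp]; linear_combination D.1 * h
  refine ⟨fun h0 => hX ?_, fun h1 => hXD ?_, key⟩
  · rw [key, h0, zero_smul]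
  · rw [key, h1, one_smul]

section Aligned

variable {x y z : ℝ × ℝ} {ρ : ℝ}

theorem dist2_eq_of_aligned (h : x - y = ρ • (z - y)) :
    dist2 x y = |ρ| * dist2 y z ∧ dist2 x z = |1 - ρ| * dist2 y z := by
  have h1 := congrArg Prod.fst h
  have h2 := congrArg Prod.snd h
  simp only [Prod.fst_sub, Prod.snd_sub, Prod.smul_fst, Prod.smul_snd, smul_eq_mul] at h1 h2
  have h3 : x.1 - z.1 = (1 - ρ) * (y.1 - z.1) := by linear_combination h1
  have h4 : x.2 - z.2 = (1 - ρ) * (y.2 - z.2) := by linear_combination h2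
  constructor
  · rw [dist2, dist2, ← Real.sqrt_sq_eq_abs, ← Real.sqrt_mul (sq_nonneg ρ), h1, h2]
    congr 1; ring
  · rw [dist2, dist2, ← Real.sqrt_sq_eq_abs, ← Real.sqrt_mul (sq_nonneg (1 - ρ)), h3, h4]
    congr 1; ring

theorem boolSign_of_aligned (hyz : y ≠ z) (h : x - y = ρ • (z - y)) :
    boolSign (decide (0 < dotp (x - y) (z - y))) * |ρ| = ρ ∧
    boolSign (decide (dotp (x - y) (z - y) < dotp (z - y) (z - y))) * |1 - ρ| = 1 - ρ := by
  have hD := dotp_self_pos (sub_ne_zero.mpr hyz.symm)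
  have h1 : dotp (x - y) (z - y) = ρ * dotp (z - y) (z - y) := by
    rw [h]; simp only [dotp, Prod.smul_fst, Prod.smul_snd, smul_eq_mul]; ring
  have h2 : (0 < dotp (x - y) (z - y)) = (0 < ρ) := by
    rw [h1]; exact propext (mul_pos_iff_of_pos_right hD)
  have h3 : (dotp (x - y) (z - y) < dotp (z - y) (z - y)) = (0 < 1 - ρ) := by
    rw [h1, ← sub_pos, show dotp (z - y) (z - y) - ρ * dotp (z - y) (z - y)
      = (1 - ρ) * dotp (z - y) (z - y) by ring]
    exact propext (mul_pos_iff_of_pos_right hD)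
  simp only [h2, h3]
  exact ⟨boolSign_decide_pos_mul_abs ρ, boolSign_decide_pos_mul_abs (1 - ρ)⟩

/-- The elongation rates of the three sides of an aligned triangle are linearly related. -/
theorem elongation_relation (hyz : y ≠ z) (hρ0 : ρ ≠ 0) (hρ1 : ρ ≠ 1)
    (h : x - y = ρ • (z - y)) (u v w : ℝ × ℝ) :
    boolSign (decide (0 < dotp (x - y) (z - y))) * (dotp (x - y) (u - v) / dist2 x y)
      + boolSign (decide (dotp (x - y) (z - y) < dotp (z - y) (z - y)))
        * (dotp (x - z) (u - w) / dist2 x z)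
      - dotp (y - z) (v - w) / dist2 y z = 0 := by
  obtain ⟨hα, hβ⟩ := boolSign_of_aligned hyz h
  obtain ⟨hd1, hd2⟩ := dist2_eq_of_aligned h
  have hd := dist2_pos hyz
  have ha : |ρ| ≠ 0 := abs_ne_zero.mpr hρ0
  have hb : |1 - ρ| ≠ 0 := abs_ne_zero.mpr (sub_ne_zero.mpr (Ne.symm hρ1))
  have ea := sq_abs ρ
  have eb := sq_abs (1 - ρ)
  rw [hd1, hd2]
  generalize boolSign (decide (0 < dotp (x - y) (z - y))) = α at *
  generalize boolSign (decide (dotp (x - y) (z - y) < dotp (z - y) (z - y))) = β at *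
  have h1 := congrArg Prod.fst h
  have h2 := congrArg Prod.snd h
  simp only [Prod.fst_sub, Prod.snd_sub, Prod.smul_fst, Prod.smul_snd, smul_eq_mul] at h1 h2
  have hxy : ∀ t : ℝ × ℝ, dotp (x - y) t = ρ * dotp (z - y) t := fun t => by
    simp only [dotp, Prod.fst_sub, Prod.snd_sub]; linear_combination t.1 * h1 + t.2 * h2
  have hxz : ∀ t : ℝ × ℝ, dotp (x - z) t = -(1 - ρ) * dotp (z - y) t := fun t => by
    simp only [dotp, Prod.fst_sub, Prod.snd_sub]; linear_combination t.1 * h1 + t.2 * h2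
  have hα' : α * ρ = |ρ| := by
    apply mul_right_cancel₀ ha; rw [← sq, ea]; linear_combination ρ * hα
  have hβ' : β * (1 - ρ) = |1 - ρ| := by
    apply mul_right_cancel₀ hb; rw [← sq, eb]; linear_combination (1 - ρ) * hβ
  have t1 : α * (dotp (x - y) (u - v) / (|ρ| * dist2 y z))
      = dotp (z - y) (u - v) / dist2 y z := by
    rw [hxy]; field_simp; linear_combination dotp (z - y) (u - v) * hα'
  have t2 : β * (dotp (x - z) (u - w) / (|1 - ρ| * dist2 y z))
      = -dotp (z - y) (u - w) / dist2 y z := by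
    rw [hxz]; field_simp; linear_combination -dotp (z - y) (u - w) * hβ'
  rw [t1, t2]
  field_simp
  simp only [dotp, Prod.fst_sub, Prod.snd_sub]; ring

/-- The stress form of an aligned triangle has rank one. -/
theorem stress_rank_one (hyz : y ≠ z) (hρ0 : ρ ≠ 0) (hρ1 : ρ ≠ 1)
    (h : x - y = ρ • (z - y)) (u v w u' v' w' : ℝ × ℝ) :
    boolSign (decide (0 < dotp (x - y) (z - y)))
        * (crs (x - y) (u - v) * crs (x - y) (u' - v') / dist2 x y ^ 3)
      + boolSign (decide (dotp (x - y) (z - y) < dotp (z - y) (z - y)))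
        * (crs (x - z) (u - w) * crs (x - z) (u' - w') / dist2 x z ^ 3)
      - crs (y - z) (v - w) * crs (y - z) (v' - w') / dist2 y z ^ 3
    = (dist2 y z ^ 3 * ρ * (1 - ρ))⁻¹ * ((crs (u - v) (z - y) + crs (x - y) (w - v))
        * (crs (u' - v') (z - y) + crs (x - y) (w' - v'))) := by
  obtain ⟨hα, hβ⟩ := boolSign_of_aligned hyz h
  obtain ⟨hd1, hd2⟩ := dist2_eq_of_aligned h
  have hd := dist2_pos hyz
  have hρ1' : 1 - ρ ≠ 0 := sub_ne_zero.mpr (Ne.symm hρ1)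
  have ha : |ρ| ≠ 0 := abs_ne_zero.mpr hρ0
  have hb : |1 - ρ| ≠ 0 := abs_ne_zero.mpr hρ1'
  have ea := sq_abs ρ
  have eb := sq_abs (1 - ρ)
  rw [hd1, hd2]
  generalize boolSign (decide (0 < dotp (x - y) (z - y))) = α at *
  generalize boolSign (decide (dotp (x - y) (z - y) < dotp (z - y) (z - y))) = β at *
  have h1 := congrArg Prod.fst h
  have h2 := congrArg Prod.snd h
  simp only [Prod.fst_sub, Prod.snd_sub, Prod.smul_fst, Prod.smul_snd, smul_eq_mul] at h1 h2
  have hxy : ∀ t : ℝ × ℝ, crs (x - y) t = ρ * crs (z - y) t := fun t => by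
    simp only [crs, Prod.fst_sub, Prod.snd_sub]; linear_combination t.2 * h1 - t.1 * h2
  have hxz : ∀ t : ℝ × ℝ, crs (x - z) t = -(1 - ρ) * crs (z - y) t := fun t => by
    simp only [crs, Prod.fst_sub, Prod.snd_sub]; linear_combination t.2 * h1 - t.1 * h2
  have hyz' : ∀ t : ℝ × ℝ, crs (y - z) t = -crs (z - y) t := fun t => by
    simp only [crs, Prod.fst_sub, Prod.snd_sub]; ring
  have hsub : crs (z - y) (u - w) = crs (z - y) (u - v) - crs (z - y) (w - v) := by
    simp only [crs, Prod.fst_sub, Prod.snd_sub]; ring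
  have hsub' : crs (z - y) (u' - w') = crs (z - y) (u' - v') - crs (z - y) (w' - v') := by
    simp only [crs, Prod.fst_sub, Prod.snd_sub]; ring
  have hneg : ∀ s t : ℝ × ℝ, crs s t = -crs t s := fun s t => by simp only [crs]; ring
  have hn : crs (z - y) (v - w) = -crs (z - y) (w - v) := by
    simp only [crs, Prod.fst_sub, Prod.snd_sub]; ring
  have hn' : crs (z - y) (v' - w') = -crs (z - y) (w' - v') := by
    simp only [crs, Prod.fst_sub, Prod.snd_sub]; ring
  rw [hneg (u - v), hneg (u' - v'), hyz', hyz', hn, hn']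
  simp only [hxy, hxz, hsub, hsub']
  generalize crs (z - y) (u - v) = A
  generalize crs (z - y) (u' - v') = A'
  generalize crs (z - y) (w - v) = B
  generalize crs (z - y) (w' - v') = B'
  have hα' : α / |ρ| = 1 / ρ := by
    rw [div_eq_div_iff ha hρ0]; apply mul_right_cancel₀ ha
    rw [one_mul, ← sq, ea]; linear_combination ρ * hα
  have hβ' : β / |1 - ρ| = 1 / (1 - ρ) := by
    rw [div_eq_div_iff hb hρ1']; apply mul_right_cancel₀ hb
    rw [one_mul, ← sq, eb]; linear_combination (1 - ρ) * hβ
  have t1 : α * (ρ * A * (ρ * A') / (|ρ| * dist2 y z) ^ 3) = A * A' / (ρ * dist2 y z ^ 3) := by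
    rw [show α * (ρ * A * (ρ * A') / (|ρ| * dist2 y z) ^ 3)
      = (α / |ρ|) * (ρ ^ 2 * A * A' / (|ρ| ^ 2 * dist2 y z ^ 3)) by field_simp, hα', ea]
    field_simp
  have t2 : ∀ C C' : ℝ, β * (-(1 - ρ) * C * (-(1 - ρ) * C') / (|1 - ρ| * dist2 y z) ^ 3)
      = C * C' / ((1 - ρ) * dist2 y z ^ 3) := by
    intro C C'
    rw [show β * (-(1 - ρ) * C * (-(1 - ρ) * C') / (|1 - ρ| * dist2 y z) ^ 3)
      = (β / |1 - ρ|) * ((1 - ρ) ^ 2 * C * C' / (|1 - ρ| ^ 2 * dist2 y z ^ 3)) by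
        field_simp, hβ', eb]
    field_simp
  rw [t1, t2]
  field_simp
  ring

end Aligned

/-- A point is determined by its distances to two others and by the side on which it lies. -/
theorem eq_rotate_of_dotp_eq {c s : ℝ} {D X X' : ℝ × ℝ} (hcs : c ^ 2 + s ^ 2 = 1) (hD : D ≠ 0)
    (h1 : dotp X' X' = dotp X X)
    (h2 : dotp (X' - (c * D.1 - s * D.2, s * D.1 + c * D.2))
      (X' - (c * D.1 - s * D.2, s * D.1 + c * D.2)) = dotp (X - D) (X - D))
    (h3 : SignType.sign (crs (c * D.1 - s * D.2, s * D.1 + c * D.2) X')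
      = SignType.sign (crs D X)) :
    X' = (c * X.1 - s * X.2, s * X.1 + c * X.2) := by
  have hDD := dotp_self_pos hD
  simp only [dotp, crs, Prod.fst_sub, Prod.snd_sub] at *
  set P := c * D.1 - s * D.2 with hP
  set Q := s * D.1 + c * D.2 with hQ
  have hPQ : P * P + Q * Q = D.1 * D.1 + D.2 * D.2 := by
    rw [hP, hQ]; linear_combination (D.1 * D.1 + D.2 * D.2) * hcs
  have hdot : P * X'.1 + Q * X'.2 = D.1 * X.1 + D.2 * X.2 := by linarith
  have hsq : (P * X'.2 - Q * X'.1) ^ 2 = (D.1 * X.2 - D.2 * X.1) ^ 2 := by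
    have e1 : (P * X'.2 - Q * X'.1) ^ 2
      = (P * P + Q * Q) * (X'.1 * X'.1 + X'.2 * X'.2) - (P * X'.1 + Q * X'.2) ^ 2 := by ring
    rw [e1, hPQ, h1, hdot]; ring
  have hcr : P * X'.2 - Q * X'.1 = D.1 * X.2 - D.2 * X.1 := by
    rcases sq_eq_sq_iff_eq_or_eq_neg.mp hsq with h | h
    · exact h
    · rw [h, Left.sign_neg, SignType.neg_eq_self_iff, sign_eq_zero_iff] at h3
      rw [h, h3, neg_zero]
  have e1 : (D.1 * D.1 + D.2 * D.2) * X'.1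
      = (D.1 * D.1 + D.2 * D.2) * (c * X.1 - s * X.2) := by
    calc _ = P * (P * X'.1 + Q * X'.2) - Q * (P * X'.2 - Q * X'.1) := by rw [← hPQ]; ring
      _ = _ := by rw [hdot, hcr, hP, hQ]; ring
  have e2 : (D.1 * D.1 + D.2 * D.2) * X'.2
      = (D.1 * D.1 + D.2 * D.2) * (s * X.1 + c * X.2) := by
    calc _ = Q * (P * X'.1 + Q * X'.2) + P * (P * X'.2 - Q * X'.1) := by rw [← hPQ]; ring
      _ = _ := by rw [hdot, hcr, hP, hQ]; ring
  exact Prod.ext (mul_left_cancel₀ hDD.ne' e1) (mul_left_cancel₀ hDD.ne' e2)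

/-! ### Construction orders of triangulated Laman graphs -/

/-- The edge joining two adjacent vertices. -/
def edgeOf {V : Type*} {G : SimpleGraph V} {i j : V} (h : G.Adj i j) : G.edgeSet :=
  ⟨s(i, j), G.mem_edgeSet.mpr h⟩

theorem edgeOf_eq_iff {V : Type*} {G : SimpleGraph V} {i j k l : V} {h : G.Adj i j}
    {h' : G.Adj k l} : edgeOf h = edgeOf h' ↔ i = k ∧ j = l ∨ i = l ∧ j = k := by
  rw [edgeOf, edgeOf, Subtype.mk_eq_mk, Sym2.eq_iff]

theorem edgeOf_symm {V : Type*} {G : SimpleGraph V} {i j : V} (h : G.Adj i j) :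
    edgeOf h.symm = edgeOf h :=
  edgeOf_eq_iff.mpr (Or.inr ⟨rfl, rfl⟩)

/-- A construction order of a triangulated Laman graph: the vertex `σ k` with `2 ≤ k` is joined
to the two adjacent earlier vertices `σ (p k)` and `σ (q k)`. -/
structure ConstructionOrder {N : ℕ} (G : SimpleGraph (Fin N)) where
  two_le : 2 ≤ N
  σ : Equiv.Perm (Fin N)
  p : Fin N → Fin N
  q : Fin N → Fin N
  p_lt : ∀ k : Fin N, 2 ≤ (k : ℕ) → p k < k
  q_lt : ∀ k : Fin N, 2 ≤ (k : ℕ) → q k < k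
  p_ne_q : ∀ k : Fin N, 2 ≤ (k : ℕ) → p k ≠ q k
  adj_parents : ∀ k : Fin N, 2 ≤ (k : ℕ) → G.Adj (σ (p k)) (σ (q k))
  adj_p : ∀ k : Fin N, 2 ≤ (k : ℕ) → G.Adj (σ k) (σ (p k))
  adj_q : ∀ k : Fin N, 2 ≤ (k : ℕ) → G.Adj (σ k) (σ (q k))
  adj_base : G.Adj (σ ⟨1, two_le⟩) (σ ⟨0, by omega⟩)
  adj_cases : ∀ i j : Fin N, j < i → G.Adj (σ i) (σ j) →
    ((i : ℕ) = 1 ∧ (j : ℕ) = 0) ∨ (2 ≤ (i : ℕ) ∧ (j = p i ∨ j = q i))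

theorem IsTLG.nonempty_constructionOrder {N : ℕ} {G : SimpleGraph (Fin N)} (hG : IsTLG G) :
    Nonempty (ConstructionOrder G) := by
  obtain ⟨hN, σ, p, q, hpar, hadj⟩ := hG
  refine ⟨⟨hN, σ, p, q, fun k hk => (hpar k hk).1, fun k hk => (hpar k hk).2.1,
    fun k hk => (hpar k hk).2.2.1, fun k hk => (hpar k hk).2.2.2,
    fun k hk => (hadj _ _).mpr (Or.inr (Or.inr (Or.inl ⟨hk, Or.inl rfl⟩))),
    fun k hk => (hadj _ _).mpr (Or.inr (Or.inr (Or.inl ⟨hk, Or.inr rfl⟩))),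
    (hadj _ _).mpr (Or.inr (Or.inl ⟨rfl, rfl⟩)), fun i j hji h => ?_⟩⟩
  have hji' : (j : ℕ) < i := hji
  rcases (hadj i j).mp h with h | h | h | ⟨h2, h | h⟩
  · omega
  · exact Or.inl h
  · exact Or.inr h
  · have : (p j : ℕ) < j := (hpar j h2).1
    rw [← h] at this; omega
  · have : (q j : ℕ) < j := (hpar j h2).2.1
    rw [← h] at this; omega

namespace ConstructionOrder

variable {N : ℕ} {G : SimpleGraph (Fin N)} (H : ConstructionOrder G)

/-- The indices of the vertices added after the initial edge. -/
abbrev Idx (_ : ConstructionOrder G) : Type := {k : Fin N // 2 ≤ (k : ℕ)}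

/-- The vertex added at stage `k`. -/
abbrev apex (k : H.Idx) : Fin N := H.σ k.1

/-- The first of the vertices to which the vertex added at stage `k` is joined. -/
abbrev left (k : H.Idx) : Fin N := H.σ (H.p k.1)

/-- The second of the vertices to which the vertex added at stage `k` is joined. -/
abbrev right (k : H.Idx) : Fin N := H.σ (H.q k.1)

theorem adj_left (k : H.Idx) : G.Adj (H.apex k) (H.left k) := H.adj_p k.1 k.2

theorem adj_right (k : H.Idx) : G.Adj (H.apex k) (H.right k) := H.adj_q k.1 k.2

theorem adj_left_right (k : H.Idx) : G.Adj (H.left k) (H.right k) := H.adj_parents k.1 k.2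

/-- The linear relation between the rates of change of the side lengths of the `k`-th triangle
when its vertices are aligned in the order encoded by the signs `α k` and `β k`. -/
def row (α β : H.Idx → Bool) (k : H.Idx) : (G.edgeSet → ℝ) →ₗ[ℝ] ℝ :=
  boolSign (α k) • LinearMap.proj (edgeOf (H.adj_left k))
    + boolSign (β k) • LinearMap.proj (edgeOf (H.adj_right k))
    - LinearMap.proj (edgeOf (H.adj_left_right k))

theorem row_apply (α β : H.Idx → Bool) (k : H.Idx) (g : G.edgeSet → ℝ) :
    H.row α β k g = boolSign (α k) * g (edgeOf (H.adj_left k))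
      + boolSign (β k) * g (edgeOf (H.adj_right k))
      - g (edgeOf (H.adj_left_right k)) := rfl

theorem boolSign_mul_self (b : Bool) : boolSign b * boolSign b = 1 := by
  cases b <;> simp [boolSign]

/-- The rows are linearly independent. -/
theorem exists_row_eq (α β : H.Idx → Bool) (μ : H.Idx → ℝ) :
    ∃ g : G.edgeSet → ℝ, ∀ k, H.row α β k g = μ k := by
  suffices ∀ n : ℕ, ∃ g : G.edgeSet → ℝ, ∀ k : H.Idx, (k.1 : ℕ) < n → H.row α β k g = μ k by
    obtain ⟨g, hg⟩ := this N
    exact ⟨g, fun k => hg k k.1.2⟩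
  intro n
  induction n with
  | zero => exact ⟨0, fun k hk => absurd hk (Nat.not_lt_zero _)⟩
  | succ n ih =>
    obtain ⟨g, hg⟩ := ih
    by_cases hn : 2 ≤ n ∧ n < N
    swap
    · refine ⟨g, fun k hk => hg k ?_⟩
      have h1 := k.2
      have h2 := k.1.2
      omega
    let m : H.Idx := ⟨⟨n, hn.2⟩, hn.1⟩
    have hp : ∀ k : H.Idx, (H.p k.1 : ℕ) < k.1 := fun k => H.p_lt k.1 k.2
    have hq : ∀ k : H.Idx, (H.q k.1 : ℕ) < k.1 := fun k => H.q_lt k.1 k.2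
    have hpq : ∀ k : H.Idx, (H.p k.1 : ℕ) ≠ H.q k.1 :=
      fun k h => H.p_ne_q k.1 k.2 (Fin.ext h)
    set e : G.edgeSet := edgeOf (H.adj_left m) with he
    have hne : ∀ i j : Fin N, (hij : G.Adj (H.σ i) (H.σ j)) →
        ((i : ℕ) < n ∧ (j : ℕ) < n ∨ (i : ℕ) = n ∧ (j : ℕ) = H.q m.1) →
        edgeOf hij ≠ e := by
      intro i j hij h heq
      have h1 := hp m
      have h2 := hpq m
      have hm : (m.1 : ℕ) = n := rfl
      rw [he, edgeOf_eq_iff, apex, left] at heq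
      simp only [H.σ.injective.eq_iff, Fin.ext_iff] at heq
      omega
    refine ⟨Function.update g e (boolSign (α m) * (μ m
      - boolSign (β m) * g (edgeOf (H.adj_right m))
      + g (edgeOf (H.adj_left_right m)))), fun k hk => ?_⟩
    have h1 := hp k
    have h2 := hq k
    rw [row_apply]
    rcases Nat.lt_succ_iff_lt_or_eq.mp hk with hk | hk
    · rw [Function.update_of_ne (hne _ _ _ (Or.inl ⟨hk, h1.trans hk⟩)),
        Function.update_of_ne (hne _ _ _ (Or.inl ⟨hk, h2.trans hk⟩)),
        Function.update_of_ne (hne _ _ _ (Or.inl ⟨h1.trans hk, h2.trans hk⟩))]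
      exact hg k hk
    · obtain rfl : k = m := Subtype.ext (Fin.ext hk)
      have h3 : edgeOf (H.adj_right m) ≠ e := hne _ _ _ (Or.inr ⟨hk, rfl⟩)
      have h4 : edgeOf (H.adj_left_right m) ≠ e := hne _ _ _ (Or.inl ⟨hk ▸ h1, hk ▸ h2⟩)
      rw [Function.update_of_ne h3, Function.update_of_ne h4, he, Function.update_self]
      linear_combination (μ m
        - boolSign (β m) * g (edgeOf (H.adj_right m))
        + g (edgeOf (H.adj_left_right m))) * boolSign_mul_self (α m)

/-- The edge functions satisfying the alignment relations of the triangles in `T`. -/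
def alignedSpace (T : Set H.Idx) (α β : H.Idx → Bool) : Submodule ℝ (G.edgeSet → ℝ) :=
  ⨅ k : T, LinearMap.ker (H.row α β k)

theorem mem_alignedSpace {T : Set H.Idx} {α β : H.Idx → Bool} {g : G.edgeSet → ℝ} :
    g ∈ H.alignedSpace T α β ↔ ∀ k ∈ T, H.row α β k g = 0 := by
  simp [alignedSpace]

/-- The ensembles for which no balanced edge function satisfies a redundant alignment relation. -/
def genericEnsembles : Set (G.edgeSet → FF) :=
  ⋂ i : {i : Set H.Idx × (H.Idx → Bool) × (H.Idx → Bool) × H.Idx // i.2.2.2 ∉ i.1},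
    {ω | ∀ d, IsBalanced ω (H.alignedSpace i.1.1 i.1.2.1 i.1.2.2.1) d →
      H.row i.1.2.1 i.1.2.2.1 i.1.2.2.2 d ≠ 0}

theorem isOpen_dense_genericEnsembles :
    IsOpen H.genericEnsembles ∧ Dense H.genericEnsembles := by
  refine exists_isOpen_dense_of_finite
    (fun i => isOpen_setOf_forall_isBalanced_ne_zero _ _)
    (fun i => dense_setOf_forall_isBalanced_ne_zero _ _ ?_)
  obtain ⟨⟨T, α, β, k₀⟩, hk₀⟩ := i
  obtain ⟨g, hg⟩ := H.exists_row_eq α β (Pi.single k₀ 1)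
  refine ⟨g, (H.mem_alignedSpace).mpr fun k hk => ?_, ?_⟩
  · rw [hg, Pi.single_eq_of_ne]
    rintro rfl
    exact hk₀ hk
  · change H.row α β k₀ g ≠ 0
    rw [hg, Pi.single_eq_same]
    exact one_ne_zero

theorem row_ne_zero_of_mem_genericEnsembles {ω : G.edgeSet → FF} (hω : ω ∈ H.genericEnsembles)
    {T : Set H.Idx} {α β : H.Idx → Bool} {d : G.edgeSet → ℝ}
    (hd : IsBalanced ω (H.alignedSpace T α β) d) {k : H.Idx} (hk : k ∉ T) :
    H.row α β k d ≠ 0 :=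
  mem_iInter.mp hω ⟨⟨T, α, β, k⟩, hk⟩ d hd

end ConstructionOrder

/-! ### Configurations of a triangulated Laman graph -/

namespace ConstructionOrder

variable {N : ℕ} {G : SimpleGraph (Fin N)} (H : ConstructionOrder G)

/-- Twice the signed area of the `k`-th triangle. -/
def orient (x : Fin N → ℝ × ℝ) (k : H.Idx) : ℝ :=
  crs (x (H.right k) - x (H.left k)) (x (H.apex k) - x (H.left k))

/-- The rate of change of the signed area of the `k`-th triangle, up to a factor. -/
def twist (x v : Fin N → ℝ × ℝ) (k : H.Idx) : ℝ :=
  crs (v (H.apex k) - v (H.left k)) (x (H.right k) - x (H.left k))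
    + crs (x (H.apex k) - x (H.left k)) (v (H.right k) - v (H.left k))

/-- Whether the apex of the `k`-th triangle lies on the same side of its left vertex as its right
vertex. -/
noncomputable def leftSign (x : Fin N → ℝ × ℝ) (k : H.Idx) : Bool :=
  decide (0 < dotp (x (H.apex k) - x (H.left k)) (x (H.right k) - x (H.left k)))

/-- Whether the apex of the `k`-th triangle lies on the same side of its right vertex as its left
vertex. -/
noncomputable def rightSign (x : Fin N → ℝ × ℝ) (k : H.Idx) : Bool :=
  decide (dotp (x (H.apex k) - x (H.left k)) (x (H.right k) - x (H.left k))
    < dotp (x (H.right k) - x (H.left k)) (x (H.right k) - x (H.left k)))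

/-- In an aligned triangle of a collision-free configuration the apex divides the base in a
ratio different from `0` and `1`. -/
theorem exists_ratio {x : Fin N → ℝ × ℝ} (hx : InConfigSpace G x) {k : H.Idx}
    (hk : H.orient x k = 0) : ∃ ρ : ℝ, ρ ≠ 0 ∧ ρ ≠ 1 ∧
      x (H.apex k) - x (H.left k) = ρ • (x (H.right k) - x (H.left k)) :=
  exists_smul_of_crs_eq_zero (sub_ne_zero.mpr (hx _ _ (H.adj_left_right k).symm))
    (sub_ne_zero.mpr (hx _ _ (H.adj_left k)))
    (fun h => hx _ _ (H.adj_right k) (sub_left_injective h)) hk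

theorem boolSign_ne_zero (b : Bool) : boolSign b ≠ 0 := by
  cases b <;> simp [boolSign]

/-- The position of a new vertex can be perturbed so that its two edges have prescribed elongation
rates, and so that the twist is prescribed as well if the triangle is aligned. -/
theorem exists_velocity {x : Fin N → ℝ × ℝ} (hx : InConfigSpace G x) (k : H.Idx)
    {g : G.edgeSet → ℝ}
    (hg : H.orient x k = 0 → H.row (H.leftSign x) (H.rightSign x) k g = 0) (μ : ℝ) (v w : ℝ × ℝ)
    (hvw : dotp (x (H.left k) - x (H.right k)) (v - w)
      = dist2 (x (H.left k)) (x (H.right k)) * g (edgeOf (H.adj_left_right k))) :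
    ∃ u : ℝ × ℝ,
      dotp (x (H.apex k) - x (H.left k)) (u - v)
        = dist2 (x (H.apex k)) (x (H.left k)) * g (edgeOf (H.adj_left k)) ∧
      dotp (x (H.apex k) - x (H.right k)) (u - w)
        = dist2 (x (H.apex k)) (x (H.right k)) * g (edgeOf (H.adj_right k)) ∧
      (H.orient x k = 0 → crs (u - v) (x (H.right k) - x (H.left k))
        + crs (x (H.apex k) - x (H.left k)) (w - v) = μ) := by
  by_cases hk : H.orient x k = 0
  · obtain ⟨ρ, hρ0, hρ1, hρ⟩ := H.exists_ratio hx hk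
    have hyz := hx _ _ (H.adj_left_right k)
    have hg := hg hk
    have hel := fun u => elongation_relation hyz hρ0 hρ1 hρ u v w
    have hd1 := dist2_pos (hx _ _ (H.adj_left k))
    have hd2 := dist2_pos (hx _ _ (H.adj_right k))
    have hd3 := dist2_pos hyz
    rw [row_apply, leftSign, rightSign] at hg
    have hD := dotp_self_pos (sub_ne_zero.mpr hyz.symm)
    generalize x (H.apex k) = a at *
    generalize x (H.left k) = b at *
    generalize x (H.right k) = c at *
    have hdet : (a - b).1 * (-(c - b).1) - (a - b).2 * (c - b).2 ≠ 0 := by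
      rw [hρ, Prod.smul_fst, Prod.smul_snd, smul_eq_mul, smul_eq_mul]
      intro h
      refine mul_ne_zero hρ0 hD.ne' ?_
      simp only [dotp]
      linear_combination -h
    obtain ⟨u, hu1, hu2⟩ := exists_linear_solution hdet
      (dist2 a b * g (edgeOf (H.adj_left k)))
      (μ - crs (a - b) (w - v))
    refine ⟨u + v, ?_, ?_, fun _ => ?_⟩
    · rw [add_sub_cancel_right]; exact hu1
    · have h := hel (u + v)
      rw [add_sub_cancel_right, show dotp (a - b) u = _ from hu1, hvw,
        mul_div_cancel_left₀ _ hd1.ne', mul_div_cancel_left₀ _ hd3.ne'] at h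
      have h2 := mul_left_cancel₀ (boolSign_ne_zero _) (show
        boolSign (decide (dotp (a - b) (c - b) < dotp (c - b) (c - b)))
          * (dotp (a - c) (u + v - w) / dist2 a c)
        = boolSign (decide (dotp (a - b) (c - b) < dotp (c - b) (c - b)))
          * g (edgeOf (H.adj_right k)) by linear_combination h - hg)
      rw [div_eq_iff hd2.ne'] at h2
      rw [h2, mul_comm]
    · rw [add_sub_cancel_right]
      simp only [crs] at hu2 ⊢
      linear_combination hu2
  · have hdet : (x (H.apex k) - x (H.left k)).1 * (x (H.apex k) - x (H.right k)).2
        - (x (H.apex k) - x (H.left k)).2 * (x (H.apex k) - x (H.right k)).1 ≠ 0 := by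
      intro h
      refine hk ?_
      simp only [orient, crs, Prod.fst_sub, Prod.snd_sub] at h ⊢
      linear_combination h
    obtain ⟨u, hu1, hu2⟩ := exists_linear_solution hdet
      (dist2 (x (H.apex k)) (x (H.left k)) * g (edgeOf (H.adj_left k))
        + dotp (x (H.apex k) - x (H.left k)) v)
      (dist2 (x (H.apex k)) (x (H.right k)) * g (edgeOf (H.adj_right k))
        + dotp (x (H.apex k) - x (H.right k)) w)
    refine ⟨u, ?_, ?_, fun h => absurd h hk⟩
    · simp only [dotp, Prod.fst_sub, Prod.snd_sub] at hu1 ⊢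
      linear_combination hu1
    · simp only [dotp, Prod.fst_sub, Prod.snd_sub] at hu2 ⊢
      linear_combination hu2

/-- Every collection of edge elongation rates compatible with the aligned triangles is realized by
a velocity field, with arbitrary twists of the aligned triangles. -/
theorem exists_velocities {x : Fin N → ℝ × ℝ} (hx : InConfigSpace G x) {g : G.edgeSet → ℝ}
    (hg : ∀ k, H.orient x k = 0 → H.row (H.leftSign x) (H.rightSign x) k g = 0)
    (μ : H.Idx → ℝ) :
    ∃ w : Fin N → ℝ × ℝ,
      (∀ i j (h : G.Adj i j),
        dotp (x i - x j) (w i - w j) = dist2 (x i) (x j) * g (edgeOf h)) ∧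
      ∀ k, H.orient x k = 0 → H.twist x w k = μ k := by
  suffices ∀ n : ℕ, ∃ w : Fin N → ℝ × ℝ,
      (∀ i j : Fin N, j < i → (i : ℕ) < n → ∀ h : G.Adj (H.σ i) (H.σ j),
        dotp (x (H.σ i) - x (H.σ j)) (w (H.σ i) - w (H.σ j))
          = dist2 (x (H.σ i)) (x (H.σ j)) * g (edgeOf h)) ∧
      ∀ k, (k.1 : ℕ) < n → H.orient x k = 0 → H.twist x w k = μ k by
    obtain ⟨w, hw, hw'⟩ := this N
    refine ⟨w, fun i j h => ?_, fun k => hw' k k.1.2⟩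
    obtain ⟨i, rfl⟩ := H.σ.surjective i
    obtain ⟨j, rfl⟩ := H.σ.surjective j
    rcases lt_trichotomy j i with hji | rfl | hij
    · exact hw i j hji i.2 h
    · exact absurd h (G.loopless.irrefl _)
    · have h1 := hw j i hij j.2 h.symm
      rw [dist2_comm, ← edgeOf_symm, ← h1]
      simp only [dotp, Prod.fst_sub, Prod.snd_sub]; ring
  intro n
  induction n with
  | zero => exact ⟨0, fun i j _ h => absurd h (Nat.not_lt_zero _),
      fun k h => absurd h (Nat.not_lt_zero _)⟩
  | succ n ih =>
    obtain ⟨w, hw, hw'⟩ := ih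
    by_cases hnN : n < N
    swap
    · refine ⟨w, fun i j hij hi => hw i j hij ?_, fun k hk => hw' k ?_⟩
      · have := i.2; omega
      · have := k.1.2; omega
    suffices ∃ u : ℝ × ℝ,
        (∀ j : Fin N, (j : ℕ) < n → ∀ h : G.Adj (H.σ ⟨n, hnN⟩) (H.σ j),
          dotp (x (H.σ ⟨n, hnN⟩) - x (H.σ j)) (u - w (H.σ j))
            = dist2 (x (H.σ ⟨n, hnN⟩)) (x (H.σ j)) * g (edgeOf h)) ∧
        ∀ k : H.Idx, (k.1 : ℕ) = n → H.orient x k = 0 →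
          crs (u - w (H.left k)) (x (H.right k) - x (H.left k))
            + crs (x (H.apex k) - x (H.left k)) (w (H.right k) - w (H.left k)) = μ k by
      obtain ⟨u, hu, hu'⟩ := this
      have hne : ∀ j : Fin N, (j : ℕ) < n → H.σ j ≠ H.σ ⟨n, hnN⟩ := fun j hj h =>
        hj.ne (Fin.ext_iff.mp (H.σ.injective h))
      refine ⟨Function.update w (H.σ ⟨n, hnN⟩) u, fun i j hji hi h => ?_, fun k hk hkc => ?_⟩
      · have hji' : (j : ℕ) < i := hji
        rw [Function.update_of_ne (hne j (by omega))]
        rcases Nat.lt_succ_iff_lt_or_eq.mp hi with hi | hi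
        · rw [Function.update_of_ne (hne i hi)]
          exact hw i j hji hi h
        · obtain rfl : i = ⟨n, hnN⟩ := Fin.ext hi
          rw [Function.update_self]
          exact hu j hji' h
      · have hp : (H.p k.1 : ℕ) < k.1 := H.p_lt k.1 k.2
        have hq : (H.q k.1 : ℕ) < k.1 := H.q_lt k.1 k.2
        rw [twist, Function.update_of_ne (hne (H.p k.1) (by omega)),
          Function.update_of_ne (hne (H.q k.1) (by omega))]
        rcases Nat.lt_succ_iff_lt_or_eq.mp hk with hk | hk
        · rw [Function.update_of_ne (hne k.1 hk)]
          exact hw' k hk hkc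
        · rw [show H.apex k = H.σ ⟨n, hnN⟩ from congrArg H.σ (Fin.ext hk), Function.update_self]
          rw [← hu' k hk hkc, show H.apex k = H.σ ⟨n, hnN⟩ from congrArg H.σ (Fin.ext hk)]
    by_cases hn : 2 ≤ n
    · let m : H.Idx := ⟨⟨n, hnN⟩, hn⟩
      have hp : (H.p m.1 : ℕ) < n := H.p_lt m.1 m.2
      have hq : (H.q m.1 : ℕ) < n := H.q_lt m.1 m.2
      have hbase : dotp (x (H.left m) - x (H.right m)) (w (H.left m) - w (H.right m))
          = dist2 (x (H.left m)) (x (H.right m)) * g (edgeOf (H.adj_left_right m)) := by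
        rcases lt_or_gt_of_ne (H.p_ne_q m.1 m.2) with h | h
        · have h1 := hw _ _ h hq (H.adj_left_right m).symm
          rw [dist2_comm, ← edgeOf_symm, ← h1]
          simp only [dotp, Prod.fst_sub, Prod.snd_sub]; ring
        · exact hw _ _ h hp (H.adj_left_right m)
      obtain ⟨u, h1, h2, h3⟩ := H.exists_velocity hx m (hg m) (μ m) _ _ hbase
      refine ⟨u, fun j hj h => ?_, fun k hk hkc => ?_⟩
      · rcases H.adj_cases _ j hj h with h' | ⟨-, rfl | rfl⟩
        · have : n = 1 := h'.1
          omega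
        · exact h1
        · exact h2
      · obtain rfl : k = m := Subtype.ext (Fin.ext hk)
        exact h3 hkc
    · have hk : ∀ k : H.Idx, (k.1 : ℕ) ≠ n := fun k h => hn (h ▸ k.2)
      by_cases h1 : n = 1
      swap
      · refine ⟨0, fun j hj => ?_, fun k h => absurd h (hk k)⟩
        omega
      · subst h1
        have h0 : 0 < N := by omega
        have hb : x (H.σ ⟨1, hnN⟩) - x (H.σ ⟨0, h0⟩) ≠ 0 :=
          sub_ne_zero.mpr (hx _ _ H.adj_base)
        have hbb := dotp_self_pos hb
        refine ⟨(dist2 (x (H.σ ⟨1, hnN⟩)) (x (H.σ ⟨0, h0⟩)) * g (edgeOf H.adj_base)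
            / dotp (x (H.σ ⟨1, hnN⟩) - x (H.σ ⟨0, h0⟩))
              (x (H.σ ⟨1, hnN⟩) - x (H.σ ⟨0, h0⟩)))
            • (x (H.σ ⟨1, hnN⟩) - x (H.σ ⟨0, h0⟩)) + w (H.σ ⟨0, h0⟩),
          fun j hj h => ?_, fun k h => absurd h (hk k)⟩
        obtain rfl : j = ⟨0, h0⟩ := Fin.ext (Nat.lt_one_iff.mp hj)
        rw [add_sub_cancel_right]
        generalize x (H.σ ⟨1, hnN⟩) - x (H.σ ⟨0, _⟩) = D at *
        rw [show ∀ r : ℝ, dotp D (r • D) = r * dotp D D from fun r => by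
          simp only [dotp, Prod.smul_fst, Prod.smul_snd, smul_eq_mul]; ring,
          div_mul_cancel₀ _ hbb.ne']

end ConstructionOrder

/-- The velocity field of an infinitesimal rigid motion with rotation rate `t.1` and
translation rate `t.2`. -/
def rigidVelocity {ι : Type*} (x : ι → ℝ × ℝ) : (ℝ × ℝ × ℝ) →ₗ[ℝ] (ι → ℝ × ℝ) where
  toFun t i := (-(t.1 * (x i).2) + t.2.1, t.1 * (x i).1 + t.2.2)
  map_add' s t := by
    ext i
    · simp only [Prod.fst_add, Prod.snd_add, Pi.add_apply]; ring
    · simp only [Prod.fst_add, Prod.snd_add, Pi.add_apply]; ring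
  map_smul' r t := by
    ext i
    · simp only [Prod.smul_fst, Prod.smul_snd, smul_eq_mul, Pi.smul_apply, RingHom.id_apply]; ring
    · simp only [Prod.smul_fst, Prod.smul_snd, smul_eq_mul, Pi.smul_apply, RingHom.id_apply]; ring

theorem dotp_rigidVelocity {ι : Type*} (x : ι → ℝ × ℝ) (t : ℝ × ℝ × ℝ) (i j : ι) :
    dotp (x i - x j) (rigidVelocity x t i - rigidVelocity x t j) = 0 := by
  simp only [rigidVelocity, dotp, LinearMap.coe_mk, AddHom.coe_mk, Prod.fst_sub, Prod.snd_sub]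
  ring

theorem crs_rigidVelocity {ι : Type*} (x : ι → ℝ × ℝ) (t : ℝ × ℝ × ℝ) (i j : ι) :
    crs (x i - x j) (rigidVelocity x t i - rigidVelocity x t j)
      = t.1 * dotp (x i - x j) (x i - x j) := by
  simp only [rigidVelocity, dotp, crs, LinearMap.coe_mk, AddHom.coe_mk, Prod.fst_sub,
    Prod.snd_sub]
  ring

theorem rigidVelocity_injective {ι : Type*} {x : ι → ℝ × ℝ} {i j : ι} (h : x i ≠ x j) :
    Function.Injective (rigidVelocity x) := by
  rw [← LinearMap.ker_eq_bot, LinearMap.ker_eq_bot']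
  intro t ht
  have h1 : t.1 = 0 := by
    have := crs_rigidVelocity x t i j
    rw [ht] at this
    have h2 := dotp_self_pos (sub_ne_zero.mpr h)
    simp only [Pi.zero_apply, sub_zero, crs, Prod.fst_zero, Prod.snd_zero, mul_zero] at this
    exact (mul_eq_zero.mp this.symm).resolve_right h2.ne'
  have h2 := congrFun ht i
  simp only [rigidVelocity, LinearMap.coe_mk, AddHom.coe_mk, h1, zero_mul, neg_zero, zero_add,
    Pi.zero_apply, Prod.mk_eq_zero] at h2
  exact Prod.ext h1 (Prod.ext h2.1 h2.2)

namespace ConstructionOrder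

variable {N : ℕ} {G : SimpleGraph (Fin N)} (H : ConstructionOrder G)

theorem twist_rigidVelocity (x : Fin N → ℝ × ℝ) (t : ℝ × ℝ × ℝ) (k : H.Idx) :
    H.twist x (rigidVelocity x t) k = 0 := by
  simp only [twist, rigidVelocity, crs, LinearMap.coe_mk, AddHom.coe_mk, Prod.fst_sub,
    Prod.snd_sub]
  ring

/-- A velocity field which preserves all side lengths and the areas of the aligned triangles is
an infinitesimal rigid motion. -/
theorem exists_eq_rigidVelocity {x : Fin N → ℝ × ℝ} (hx : InConfigSpace G x)
    {v : Fin N → ℝ × ℝ} (hv : ∀ i j, G.Adj i j → dotp (x i - x j) (v i - v j) = 0)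
    (hv' : ∀ k, H.orient x k = 0 → H.twist x v k = 0) :
    ∃ t, v = rigidVelocity x t := by
  have h0N : 0 < N := lt_of_lt_of_le (by norm_num) H.two_le
  set o := H.σ ⟨0, h0N⟩ with ho
  set l := H.σ ⟨1, H.two_le⟩ with hl
  have hol : G.Adj l o := H.adj_base
  have hD := sub_ne_zero.mpr (hx _ _ hol)
  have hDD := dotp_self_pos hD
  set θ := crs (x l - x o) (v l - v o) / dotp (x l - x o) (x l - x o) with hθ
  set t : ℝ × ℝ × ℝ := (θ, (v o).1 + θ * (x o).2, (v o).2 - θ * (x o).1) with ht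
  refine ⟨t, ?_⟩
  set w : Fin N → ℝ × ℝ := v - rigidVelocity x t with hw
  have hwv : ∀ i j, w i - w j = (v i - v j) - (rigidVelocity x t i - rigidVelocity x t j) := by
    intro i j; simp only [hw, Pi.sub_apply]; abel
  have hw1 : ∀ i j, G.Adj i j → dotp (x i - x j) (w i - w j) = 0 := by
    intro i j hij
    have h1 := hv i j hij
    have h2 := dotp_rigidVelocity x t i j
    rw [hwv]
    simp only [dotp, Prod.fst_sub, Prod.snd_sub] at h1 h2 ⊢
    linear_combination h1 - h2
  have hw2 : ∀ k, H.orient x k = 0 → H.twist x w k = 0 := by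
    intro k hk
    have h1 := hv' k hk
    have h2 := H.twist_rigidVelocity x t k
    rw [twist] at h1 h2 ⊢
    rw [hwv, hwv]
    simp only [crs, Prod.fst_sub, Prod.snd_sub] at h1 h2 ⊢
    linear_combination h1 - h2
  have hwo : w o = 0 := by
    ext
    · simp only [hw, ht, rigidVelocity, LinearMap.coe_mk, AddHom.coe_mk, Pi.sub_apply,
        Prod.fst_sub, Prod.fst_zero]; ring
    · simp only [hw, ht, rigidVelocity, LinearMap.coe_mk, AddHom.coe_mk, Pi.sub_apply,
        Prod.snd_sub, Prod.snd_zero]; ring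
  have hwl : w l = 0 := by
    have h1 := hw1 l o hol
    have h2 : crs (x l - x o) (w l - w o) = 0 := by
      have h3 := crs_rigidVelocity x t l o
      have h4 : θ * dotp (x l - x o) (x l - x o) = crs (x l - x o) (v l - v o) := by
        rw [hθ, div_mul_cancel₀ _ hDD.ne']
      rw [hwv]
      simp only [ht] at h3
      rw [h4] at h3
      simp only [crs, Prod.fst_sub, Prod.snd_sub] at h3 ⊢
      linear_combination -h3
    rw [hwo, sub_zero] at h1 h2
    refine eq_zero_of_linear (a := (x l - x o).1) (b := (x l - x o).2)
      (c := -(x l - x o).2) (d := (x l - x o).1) ?_ h1 ?_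
    · intro h
      refine hDD.ne' ?_
      simp only [dotp]
      linear_combination h
    · simp only [crs] at h2
      linear_combination h2
  suffices ∀ n : ℕ, ∀ i : Fin N, (i : ℕ) = n → w (H.σ i) = 0 by
    funext i
    obtain ⟨i, rfl⟩ := H.σ.surjective i
    have := this i i rfl
    rwa [hw, Pi.sub_apply, sub_eq_zero] at this
  intro n
  induction n using Nat.strong_induction_on with
  | _ n ih =>
    intro i hi
    by_cases hn : 2 ≤ n
    · let k : H.Idx := ⟨i, hi ▸ hn⟩
      have hp : w (H.left k) = 0 :=
        ih (H.p i) (hi ▸ H.p_lt i (hi ▸ hn)) _ rfl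
      have hq : w (H.right k) = 0 :=
        ih (H.q i) (hi ▸ H.q_lt i (hi ▸ hn)) _ rfl
      have h1 := hw1 _ _ (H.adj_left k)
      have h2 := hw1 _ _ (H.adj_right k)
      rw [hp, sub_zero] at h1
      rw [hq, sub_zero] at h2
      change w (H.apex k) = 0
      by_cases hk : H.orient x k = 0
      · obtain ⟨ρ, hρ0, hρ1, hρ⟩ := H.exists_ratio hx hk
        have h3 := hw2 k hk
        rw [twist, hp, hq, sub_zero, sub_zero] at h3
        have hyz := dotp_self_pos (sub_ne_zero.mpr (hx _ _ (H.adj_left_right k).symm))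
        rw [hρ] at h1
        refine eq_zero_of_linear (a := (x (H.right k) - x (H.left k)).1)
          (b := (x (H.right k) - x (H.left k)).2) (c := -(x (H.right k) - x (H.left k)).2)
          (d := (x (H.right k) - x (H.left k)).1) ?_ ?_ ?_
        · intro h
          refine hyz.ne' ?_
          simp only [dotp]
          linear_combination h
        · refine (mul_eq_zero.mp ?_).resolve_left hρ0
          simp only [dotp, Prod.smul_fst, Prod.smul_snd, smul_eq_mul] at h1
          linear_combination h1
        · simp only [crs, Prod.fst_zero, Prod.snd_zero] at h3
          linear_combination -h3
      · refine eq_zero_of_linear (a := (x (H.apex k) - x (H.left k)).1)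
          (b := (x (H.apex k) - x (H.left k)).2) (c := (x (H.apex k) - x (H.right k)).1)
          (d := (x (H.apex k) - x (H.right k)).2) ?_ h1 h2
        intro h
        refine hk ?_
        simp only [orient, crs, Prod.fst_sub, Prod.snd_sub] at h ⊢
        linear_combination h
    · rcases (show n = 0 ∨ n = 1 by omega) with rfl | rfl
      · rwa [show i = ⟨0, h0N⟩ from Fin.ext hi]
      · rwa [show i = ⟨1, H.two_le⟩ from Fin.ext hi]

/-- Two configurations with the same edge lengths and triangle orientations are congruent. -/
theorem sameOrbit_of_dist2_eq {x y : Fin N → ℝ × ℝ} (hx : InConfigSpace G x)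
    (hd : ∀ i j, G.Adj i j → dist2 (y i) (y j) = dist2 (x i) (x j))
    (ho : ∀ k, SignType.sign (H.orient y k) = SignType.sign (H.orient x k)) :
    sameOrbit x y := by
  have h0N : 0 < N := lt_of_lt_of_le (by norm_num) H.two_le
  have hd' : ∀ i j, G.Adj i j → dotp (y i - y j) (y i - y j) = dotp (x i - x j) (x i - x j) :=
    fun i j h => by rw [← dist2_sq, ← dist2_sq, hd i j h]
  set o := H.σ ⟨0, h0N⟩
  set l := H.σ ⟨1, H.two_le⟩
  have hol : G.Adj l o := H.adj_base
  have hDD := dotp_self_pos (sub_ne_zero.mpr (hx _ _ hol))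
  have hlen := hd' l o hol
  set D := x l - x o with hD
  set D' := y l - y o with hD'
  set c := dotp D D' / dotp D D with hc
  set s := crs D D' / dotp D D with hs
  have hcs : c ^ 2 + s ^ 2 = 1 := by
    rw [hc, hs]
    field_simp
    simp only [dotp, crs] at hlen ⊢
    linear_combination (D.1 * D.1 + D.2 * D.2) * hlen
  suffices ∀ n : ℕ, ∀ i : Fin N, (i : ℕ) = n → y (H.σ i) - y o
      = (c * (x (H.σ i) - x o).1 - s * (x (H.σ i) - x o).2,
        s * (x (H.σ i) - x o).1 + c * (x (H.σ i) - x o).2) by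
    refine ⟨c, s, (y o).1 - (c * (x o).1 - s * (x o).2), (y o).2 - (s * (x o).1 + c * (x o).2),
      hcs, fun i => ?_⟩
    obtain ⟨i, rfl⟩ := H.σ.surjective i
    have h := this i i rfl
    have h1 := congrArg Prod.fst h
    have h2 := congrArg Prod.snd h
    simp only [Prod.fst_sub, Prod.snd_sub] at h1 h2
    ext
    · simp only; linear_combination h1
    · simp only; linear_combination h2
  intro n
  induction n using Nat.strong_induction_on with
  | _ n ih =>
    intro i hi
    by_cases hn : 2 ≤ n
    · let k : H.Idx := ⟨i, hi ▸ hn⟩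
      have hp := ih (H.p i) (hi ▸ H.p_lt i (hi ▸ hn)) _ rfl
      have hq := ih (H.q i) (hi ▸ H.q_lt i (hi ▸ hn)) _ rfl
      have h1 := hd' _ _ (H.adj_left k)
      have h2 := hd' _ _ (H.adj_right k)
      have hbase : y (H.right k) - y (H.left k)
          = (c * (x (H.right k) - x (H.left k)).1 - s * (x (H.right k) - x (H.left k)).2,
            s * (x (H.right k) - x (H.left k)).1 + c * (x (H.right k) - x (H.left k)).2) := by
        rw [← sub_sub_sub_cancel_right _ _ (y o), show y (H.right k) - y o = _ from hq,
          show y (H.left k) - y o = _ from hp]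
        ext
        · simp only [Prod.fst_sub, Prod.snd_sub]; ring
        · simp only [Prod.fst_sub, Prod.snd_sub]; ring
      have hsgn := ho k
      rw [orient, orient, hbase] at hsgn
      have key := eq_rotate_of_dotp_eq hcs
        (sub_ne_zero.mpr (hx _ _ (H.adj_left_right k).symm)) h1 (by
          rw [← hbase, sub_sub_sub_cancel_right, sub_sub_sub_cancel_right, h2]) hsgn
      rw [← sub_add_sub_cancel _ (y (H.left k)) (y o), show y (H.left k) - y o = _ from hp,
        show y (H.σ i) - y (H.left k) = _ from key]
      ext
      · simp only [Prod.fst_add, Prod.fst_sub, Prod.snd_sub]; ring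
      · simp only [Prod.snd_add, Prod.fst_sub, Prod.snd_sub]; ring
    · rcases (show n = 0 ∨ n = 1 by omega) with rfl | rfl
      · rw [show H.σ i = o from congrArg H.σ (Fin.ext hi), sub_self, sub_self]
        simp only [Prod.fst_zero, Prod.snd_zero, mul_zero, sub_zero, add_zero]
        rfl
      · rw [show H.σ i = l from congrArg H.σ (Fin.ext hi), ← hD, ← hD']
        have e1 : c * dotp D D = dotp D D' := div_mul_cancel₀ _ hDD.ne'
        have e2 : s * dotp D D = crs D D' := div_mul_cancel₀ _ hDD.ne'
        ext
        · apply mul_left_cancel₀ hDD.ne'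
          simp only
          rw [show dotp D D * (c * D.1 - s * D.2)
            = (c * dotp D D) * D.1 - (s * dotp D D) * D.2 by ring, e1, e2]
          simp only [dotp, crs]; ring
        · apply mul_left_cancel₀ hDD.ne'
          simp only
          rw [show dotp D D * (s * D.1 + c * D.2)
            = (s * dotp D D) * D.1 + (c * dotp D D) * D.2 by ring, e1, e2]
          simp only [dotp, crs]; ring

end ConstructionOrder

/-! ### Equilibria and stresses -/

section EdgeSums

variable {N : ℕ} {G : SimpleGraph (Fin N)}

theorem sum_adj_eq_two_mul_sum_edgeSet (g : G.edgeSet → ℝ) :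
    ∑ i, ∑ j, (if h : G.Adj i j then g (edgeOf h) else 0) = 2 * ∑ e, g e := by
  have h1 : ∀ i j, (if h : G.Adj i j then g (edgeOf h) else 0)
      = ∑ e : G.edgeSet, if s(i, j) = e.1 then g e else 0 := by
    intro i j
    split_ifs with h
    · rw [Finset.sum_eq_single (edgeOf h) (fun e _ he => if_neg fun h' => he (Subtype.ext h'.symm))
        (fun h => absurd (Finset.mem_univ _) h)]
      exact (if_pos rfl).symm
    · refine (Finset.sum_eq_zero fun e _ => if_neg fun h' => h ?_).symm
      have he := e.2
      rw [← h'] at he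
      exact G.mem_edgeSet.mp he
  simp only [h1]
  rw [← Fintype.sum_prod_type' (f := fun i j => ∑ e : G.edgeSet, if s(i, j) = e.1 then g e else 0),
    Finset.sum_comm, Finset.mul_sum]
  refine Finset.sum_congr rfl fun e _ => ?_
  obtain ⟨e, he⟩ := e
  induction e using Sym2.ind with
  | _ a b =>
    have hab : G.Adj a b := G.mem_edgeSet.mp he
    have hset : (Finset.univ.filter fun z : Fin N × Fin N => s(z.1, z.2) = s(a, b))
        = {(a, b), (b, a)} := by
      ext ⟨i, j⟩
      simp only [Finset.mem_filter, Finset.mem_univ, true_and, Finset.mem_insert,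
        Finset.mem_singleton, Prod.mk.injEq, Sym2.eq_iff]
    rw [← Finset.sum_filter, hset, Finset.sum_pair
      (fun h => hab.ne (congrArg Prod.fst h)), two_mul]

/-- The edge lengths of a configuration. -/
noncomputable def edgeLen (x : Fin N → ℝ × ℝ) (e : G.edgeSet) : ℝ :=
  Sym2.lift ⟨fun i j => dist2 (x i) (x j), fun _ _ => dist2_comm _ _⟩ e.1

theorem edgeLen_edgeOf (x : Fin N → ℝ × ℝ) {i j : Fin N} (h : G.Adj i j) :
    edgeLen x (edgeOf h) = dist2 (x i) (x j) := rfl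

theorem exists_edgeOf (e : G.edgeSet) : ∃ i j, ∃ h : G.Adj i j, e = edgeOf h := by
  obtain ⟨e, he⟩ := e
  induction e using Sym2.ind with
  | _ a b => exact ⟨a, b, G.mem_edgeSet.mp he, rfl⟩

theorem edgeLen_pos {x : Fin N → ℝ × ℝ} (hx : InConfigSpace G x) (e : G.edgeSet) :
    0 < edgeLen x e := by
  obtain ⟨i, j, h, rfl⟩ := exists_edgeOf e
  exact dist2_pos (hx i j h)

theorem ensembleLaws_of_adj (ω : G.edgeSet → FF) {i j : Fin N} (h : G.Adj i j) :
    ensembleLaws ω i j = (ω (edgeOf h)).1.1 := dif_pos h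

theorem ensembleLaws_comm (ω : G.edgeSet → FF) (i j : Fin N) :
    ensembleLaws ω i j = ensembleLaws ω j i := by
  by_cases h : G.Adj i j
  · rw [ensembleLaws_of_adj ω h, ensembleLaws_of_adj ω h.symm, edgeOf_symm]
  · rw [ensembleLaws, ensembleLaws, dif_neg h, dif_neg fun h' => h h'.symm]

/-- The principle of virtual work at an equilibrium. -/
theorem IsEquilibrium.sum_eq_zero {ω : G.edgeSet → FF} {x : Fin N → ℝ × ℝ}
    (h : IsEquilibrium G (ensembleLaws ω) x) (w : Fin N → ℝ × ℝ) :
    ∑ i, ∑ j, (if G.Adj i j then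
      ensembleLaws ω i j (dist2 (x i) (x j)) * dotp (x i - x j) (w i - w j) else 0) = 0 := by
  let L : (ℝ × ℝ) → (ℝ × ℝ) →+ ℝ := fun v =>
    { toFun := fun u => dotp u v
      map_zero' := by simp [dotp]
      map_add' := fun a b => by simp only [dotp, Prod.fst_add, Prod.snd_add]; ring }
  have h1 : ∑ i, ∑ j, (if G.Adj i j then
      ensembleLaws ω i j (dist2 (x i) (x j)) * dotp (x j - x i) (w i) else 0) = 0 := by
    refine Finset.sum_eq_zero fun i _ => ?_
    have := congrArg (L (w i)) (h i)
    rw [map_sum, map_zero] at this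
    refine Eq.trans (Finset.sum_congr rfl fun j _ => ?_) this
    split_ifs
    · simp only [L, AddMonoidHom.coe_mk, ZeroHom.coe_mk, dotp, Prod.smul_fst, Prod.smul_snd,
        smul_eq_mul]; ring
    · exact (map_zero (L (w i))).symm
  have h2 := h1
  rw [Finset.sum_comm] at h2
  calc _ = -(∑ i, ∑ j, (if G.Adj i j then
        ensembleLaws ω i j (dist2 (x i) (x j)) * dotp (x j - x i) (w i) else 0))
      - ∑ i, ∑ j, (if G.Adj j i then
        ensembleLaws ω j i (dist2 (x j) (x i)) * dotp (x i - x j) (w j) else 0) := by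
        rw [← Finset.sum_neg_distrib, ← Finset.sum_sub_distrib]
        refine Finset.sum_congr rfl fun i _ => ?_
        rw [← Finset.sum_neg_distrib, ← Finset.sum_sub_distrib]
        refine Finset.sum_congr rfl fun j _ => ?_
        simp only [G.adj_comm j i]
        split_ifs
        · rw [ensembleLaws_comm ω j i, dist2_comm (x j)]
          simp only [dotp, Prod.fst_sub, Prod.snd_sub]; ring
        · ring
    _ = 0 := by rw [h1, h2]; ring

end EdgeSums

namespace ConstructionOrder

variable {N : ℕ} {G : SimpleGraph (Fin N)} (H : ConstructionOrder G)

/-- The triangles that are aligned in a configuration. -/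
def aligned (x : Fin N → ℝ × ℝ) : Set H.Idx := {k | H.orient x k = 0}

theorem row_edgeLen {x : Fin N → ℝ × ℝ} (hx : InConfigSpace G x) {k : H.Idx}
    (hk : H.orient x k = 0) : H.row (H.leftSign x) (H.rightSign x) k (edgeLen x) = 0 := by
  obtain ⟨ρ, hρ0, hρ1, hρ⟩ := H.exists_ratio hx hk
  have h := elongation_relation (hx _ _ (H.adj_left_right k)) hρ0 hρ1 hρ
    (x (H.apex k)) (x (H.left k)) (x (H.right k))
  have hd : ∀ i j, G.Adj i j → dotp (x i - x j) (x i - x j) / dist2 (x i) (x j)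
      = dist2 (x i) (x j) := fun i j hij => by
    rw [← dist2_sq, sq, mul_div_cancel_right₀ _ (dist2_pos (hx i j hij)).ne']
  rwa [hd _ _ (H.adj_left k), hd _ _ (H.adj_right k), hd _ _ (H.adj_left_right k)] at h

/-- At an equilibrium the edge lengths are balanced. -/
theorem isBalanced_edgeLen {ω : G.edgeSet → FF} {x : Fin N → ℝ × ℝ} (hx : InConfigSpace G x)
    (he : IsEquilibrium G (ensembleLaws ω) x) :
    IsBalanced ω (H.alignedSpace (H.aligned x) (H.leftSign x) (H.rightSign x)) (edgeLen x) := by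
  refine ⟨edgeLen_pos hx, (H.mem_alignedSpace).mpr fun k hk => H.row_edgeLen hx hk,
    fun g hg => ?_⟩
  obtain ⟨w, hw, -⟩ := H.exists_velocities hx ((H.mem_alignedSpace).mp hg) 0
  have h := he.sum_eq_zero w
  have h2 := sum_adj_eq_two_mul_sum_edgeSet fun e => tildeFn (ω e).1.1 (edgeLen x e) * g e
  refine (mul_eq_zero.mp (h2.symm.trans ((Eq.trans ?_ h)))).resolve_left two_ne_zero
  refine Finset.sum_congr rfl fun i _ => Finset.sum_congr rfl fun j _ => ?_
  split_ifs with hij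
  · rw [hw i j hij, ensembleLaws_of_adj ω hij, edgeLen_edgeOf, tildeFn]; ring
  · rfl

/-- For generic ensembles, the stress of an equilibrium is a combination of the stresses of the
aligned triangles, with nonzero coefficients. -/
theorem exists_multipliers {ω : G.edgeSet → FF} (hω : ω ∈ H.genericEnsembles)
    {x : Fin N → ℝ × ℝ} (hx : InConfigSpace G x) (he : IsEquilibrium G (ensembleLaws ω) x) :
    ∃ c : H.Idx → ℝ, (∀ k, H.orient x k = 0 → c k ≠ 0) ∧ (∀ k, H.orient x k ≠ 0 → c k = 0) ∧
      ∀ g : G.edgeSet → ℝ, ∑ e, tildeFn (ω e).1.1 (edgeLen x e) * g e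
        = ∑ k, c k * H.row (H.leftSign x) (H.rightSign x) k g := by
  have hbal := H.isBalanced_edgeLen hx he
  let φ : (G.edgeSet → ℝ) →ₗ[ℝ] ℝ :=
    ∑ e, tildeFn (ω e).1.1 (edgeLen x e) • LinearMap.proj e
  have hφ : ∀ g, φ g = ∑ e, tildeFn (ω e).1.1 (edgeLen x e) * g e := fun g => by
    simp only [φ, LinearMap.sum_apply, LinearMap.smul_apply, LinearMap.proj_apply, smul_eq_mul]
  have hmem : φ ∈ Submodule.span ℝ
      (range fun k : H.aligned x => H.row (H.leftSign x) (H.rightSign x) k.1) := by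
    refine mem_span_of_iInf_ker_le_ker fun g hg => ?_
    rw [LinearMap.mem_ker, hφ]
    exact hbal.2.2 g hg
  obtain ⟨c₀, hc₀⟩ := (Submodule.mem_span_range_iff_exists_fun ℝ).mp hmem
  let c : H.Idx → ℝ := fun k => if hk : k ∈ H.aligned x then c₀ ⟨k, hk⟩ else 0
  have hc : ∀ k, H.orient x k ≠ 0 → c k = 0 := fun k hk => dif_neg hk
  have hsum : ∀ g : G.edgeSet → ℝ, ∑ e, tildeFn (ω e).1.1 (edgeLen x e) * g e
      = ∑ k, c k * H.row (H.leftSign x) (H.rightSign x) k g := by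
    intro g
    rw [← hφ, ← hc₀, LinearMap.sum_apply]
    rw [← Finset.sum_subset (Finset.subset_univ (Finset.univ.filter (· ∈ H.aligned x)))
      (fun k _ hk => by
        rw [hc k fun h => hk (Finset.mem_filter.mpr ⟨Finset.mem_univ _, h⟩), zero_mul])]
    rw [← Finset.sum_subtype_eq_sum_filter]
    simp only [Finset.subtype_univ]
    refine Finset.sum_congr rfl fun k _ => ?_
    rw [LinearMap.smul_apply, smul_eq_mul, show c k.1 = c₀ k from dif_pos k.2]
  refine ⟨c, fun k hk hck => ?_, hc, hsum⟩
  refine H.row_ne_zero_of_mem_genericEnsembles hω (T := H.aligned x \ {k})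
    (d := edgeLen x) ⟨hbal.1, ?_, fun g hg => ?_⟩ (fun h => h.2 rfl) (H.row_edgeLen hx hk)
  · exact (H.mem_alignedSpace).mpr fun k hk => (H.mem_alignedSpace).mp hbal.2.1 k hk.1
  · rw [hsum]
    refine Finset.sum_eq_zero fun l _ => ?_
    by_cases hl : H.orient x l = 0
    · by_cases hlk : l = k
      · rw [hlk, hck, zero_mul]
      · rw [(H.mem_alignedSpace).mp hg l ⟨hl, hlk⟩, mul_zero]
    · rw [hc l hl, zero_mul]

end ConstructionOrder

/-! ### The Hessian of the potential -/

/-- `g` is Fréchet differentiable at `x` with directional derivatives `D`. -/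
def HasDifferential {X : Type*} [NormedAddCommGroup X] [NormedSpace ℝ X] (g : X → ℝ) (D : X → ℝ)
    (x : X) : Prop :=
  ∃ L : X →L[ℝ] ℝ, HasFDerivAt g L x ∧ ∀ w, L w = D w

namespace HasDifferential

variable {X : Type*} [NormedAddCommGroup X] [NormedSpace ℝ X] {g : X → ℝ} {D : X → ℝ} {x : X}

theorem fderiv_apply (h : HasDifferential g D x) (w : X) : fderiv ℝ g x w = D w := by
  obtain ⟨L, hL, hL'⟩ := h
  rw [hL.fderiv, hL']

theorem half_sum {ι : Type*} [Fintype ι] {g : ι → ι → X → ℝ} {D : ι → ι → X → ℝ}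
    (h : ∀ i j, HasDifferential (g i j) (D i j) x) :
    HasDifferential (fun q => (1 / 2) * ∑ i, ∑ j, g i j q)
      (fun w => (1 / 2) * ∑ i, ∑ j, D i j w) x := by
  choose L hL hL' using h
  refine ⟨(1 / 2 : ℝ) • ∑ i, ∑ j, L i j, ?_, fun w => ?_⟩
  · exact (HasFDerivAt.fun_sum fun i _ => HasFDerivAt.fun_sum fun j _ => hL i j).const_mul _
  · simp only [_root_.smul_apply, _root_.sum_apply, hL', smul_eq_mul]

theorem ite {c : Prop} [Decidable c] (h : c → HasDifferential g D x) :
    HasDifferential (fun q => if c then g q else 0) (fun w => if c then D w else 0) x := by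
  split_ifs with hc
  · exact h hc
  · exact ⟨0, hasFDerivAt_const 0 x, fun w => rfl⟩

theorem comp (h : HasDifferential g D x) {φ : ℝ → ℝ} {φ' : ℝ} (hφ : HasDerivAt φ φ' (g x)) :
    HasDifferential (fun q => φ (g q)) (fun w => φ' * D w) x := by
  obtain ⟨L, hL, hL'⟩ := h
  refine ⟨φ' • L, hφ.comp_hasFDerivAt x hL, fun w => ?_⟩
  rw [_root_.smul_apply, hL', smul_eq_mul]

theorem mul {g₁ D₁ : X → ℝ} (h : HasDifferential g D x) (h₁ : HasDifferential g₁ D₁ x) :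
    HasDifferential (fun q => g q * g₁ q) (fun w => D w * g₁ x + g x * D₁ w) x := by
  obtain ⟨L, hL, hL'⟩ := h
  obtain ⟨L₁, hL₁, hL₁'⟩ := h₁
  refine ⟨_, hL.mul hL₁, fun w => ?_⟩
  simp only [_root_.add_apply, _root_.smul_apply, hL', hL₁', smul_eq_mul]
  ring

end HasDifferential

section Potential

variable {N : ℕ} {G : SimpleGraph (Fin N)}

theorem hasDifferential_dotp_sub (i j : Fin N) (z : ℝ × ℝ) (x : Fin N → ℝ × ℝ) :
    HasDifferential (fun q : Fin N → ℝ × ℝ => dotp (q i - q j) z)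
      (fun w => dotp (w i - w j) z) x := by
  let P : (Fin N → ℝ × ℝ) →L[ℝ] ℝ × ℝ :=
    ContinuousLinearMap.proj (R := ℝ) (φ := fun _ : Fin N => ℝ × ℝ) i
      - ContinuousLinearMap.proj (R := ℝ) (φ := fun _ : Fin N => ℝ × ℝ) j
  refine ⟨z.1 • (ContinuousLinearMap.fst ℝ ℝ ℝ).comp P
    + z.2 • (ContinuousLinearMap.snd ℝ ℝ ℝ).comp P, ?_, fun w => ?_⟩
  · refine (ContinuousLinearMap.hasFDerivAt _).congr_of_eventuallyEq (.of_forall fun q => ?_)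
    simp only [dotp, P, _root_.add_apply, _root_.smul_apply,
      ContinuousLinearMap.comp_apply, _root_.sub_apply,
      ContinuousLinearMap.proj_apply, ContinuousLinearMap.coe_fst', ContinuousLinearMap.coe_snd',
      smul_eq_mul]
    ring
  · simp only [dotp, P, _root_.add_apply, _root_.smul_apply,
      ContinuousLinearMap.comp_apply, _root_.sub_apply,
      ContinuousLinearMap.proj_apply, ContinuousLinearMap.coe_fst', ContinuousLinearMap.coe_snd',
      smul_eq_mul]
    ring

theorem hasDifferential_dist2 {i j : Fin N} {x : Fin N → ℝ × ℝ} (h : x i ≠ x j) :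
    HasDifferential (fun q : Fin N → ℝ × ℝ => dist2 (q i) (q j))
      (fun w => dotp (x i - x j) (w i - w j) / dist2 (x i) (x j)) x := by
  have hd := dist2_pos h
  have h1 := hasDifferential_dotp_sub i j (1, 0) x
  have h2 := hasDifferential_dotp_sub i j (0, 1) x
  obtain ⟨L₁, e₁, f₁⟩ := h1.mul h1
  obtain ⟨L₂, e₂, f₂⟩ := h2.mul h2
  have h3 : HasDifferential (fun q : Fin N → ℝ × ℝ => dotp (q i - q j) (q i - q j))
      (fun w => 2 * dotp (x i - x j) (w i - w j)) x := by
    refine ⟨L₁ + L₂, (e₁.add e₂).congr_of_eventuallyEq (.of_forall fun q => ?_), fun w => ?_⟩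
    · simp [dotp]
    · rw [_root_.add_apply, f₁, f₂]
      simp only [dotp]; ring
  have hne : dotp (x i - x j) (x i - x j) ≠ 0 := (dotp_self_pos (sub_ne_zero.mpr h)).ne'
  have hsqrt : ∀ y : Fin N → ℝ × ℝ, Real.sqrt (dotp (y i - y j) (y i - y j))
      = dist2 (y i) (y j) := fun y => by
    rw [← dist2_sq]; exact Real.sqrt_sq (Real.sqrt_nonneg _)
  obtain ⟨L, e, f⟩ := h3.comp (Real.hasDerivAt_sqrt hne)
  refine ⟨L, e.congr_of_eventuallyEq (.of_forall fun q => (hsqrt q).symm), fun w => ?_⟩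
  rw [f, hsqrt]
  field_simp

/-- The differential of the potential. -/
theorem hasDifferential_potential (ω : G.edgeSet → FF) {x : Fin N → ℝ × ℝ}
    (hx : InConfigSpace G x) :
    HasDifferential (potential G (ensembleLaws ω))
      (fun w => (1 / 2) * ∑ i, ∑ j, if G.Adj i j then
        ensembleLaws ω i j (dist2 (x i) (x j)) * dotp (x i - x j) (w i - w j) else 0) x := by
  refine HasDifferential.half_sum fun i j => HasDifferential.ite fun hij => ?_
  have hd := dist2_pos (hx i j hij)
  have hf : MemF (ensembleLaws ω i j) := by
    rw [ensembleLaws_of_adj ω hij]; exact (ω (edgeOf hij)).2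
  have hcont := hf.continuousOn_tildeFn
  have h1 : HasDerivAt (fun D => ∫ x in (1:ℝ)..D, x * ensembleLaws ω i j x)
      (tildeFn (ensembleLaws ω i j) (dist2 (x i) (x j))) (dist2 (x i) (x j)) :=
    intervalIntegral.integral_hasDerivAt_right
      (hf.intervalIntegrable_tildeFn one_pos hd)
      (hcont.stronglyMeasurableAtFilter isOpen_Ioi _ hd)
      (hcont.continuousAt (Ioi_mem_nhds hd))
  obtain ⟨L, e, f⟩ := (hasDifferential_dist2 (hx i j hij)).comp h1
  refine ⟨L, e, fun w => ?_⟩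
  rw [f, tildeFn]
  field_simp

/-- The second differential of the potential. -/
noncomputable def hessianForm (ω : G.edgeSet → FF) (x u w : Fin N → ℝ × ℝ) : ℝ :=
  (1 / 2) * ∑ i, ∑ j, if G.Adj i j then
    deriv (ensembleLaws ω i j) (dist2 (x i) (x j))
        * (dotp (x i - x j) (u i - u j) / dist2 (x i) (x j)) * dotp (x i - x j) (w i - w j)
      + ensembleLaws ω i j (dist2 (x i) (x j)) * dotp (u i - u j) (w i - w j) else 0

theorem isOpen_inConfigSpace : IsOpen {x : Fin N → ℝ × ℝ | InConfigSpace G x} := by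
  simp only [InConfigSpace, ofPred_forall]
  refine isOpen_iInter_of_finite fun i => isOpen_iInter_of_finite fun j =>
    isOpen_iInter_of_finite fun _ => ?_
  exact isOpen_ne_fun (continuous_apply i) (continuous_apply j)

theorem hessian_potential (ω : G.edgeSet → FF) {x : Fin N → ℝ × ℝ} (hx : InConfigSpace G x)
    (u v : Fin N ⊕ Fin N) :
    hessian (potential G (ensembleLaws ω)) x u v
      = hessianForm ω x (basisVec u) (basisVec v) := by
  have h1 : (fun q => fderiv ℝ (potential G (ensembleLaws ω)) q (basisVec v)) =ᶠ[𝓝 x]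
      fun q => (1 / 2) * ∑ i, ∑ j, if G.Adj i j then
        ensembleLaws ω i j (dist2 (q i) (q j))
          * dotp (q i - q j) (basisVec v i - basisVec v j) else 0 := by
    filter_upwards [isOpen_inConfigSpace.mem_nhds hx] with q hq
    exact (hasDifferential_potential ω hq).fderiv_apply _
  rw [hessian, Matrix.of_apply, h1.fderiv_eq]
  refine HasDifferential.fderiv_apply (D := fun u => hessianForm ω x u (basisVec v)) ?_ _
  refine HasDifferential.half_sum fun i j => HasDifferential.ite fun hij => ?_
  have hd := dist2_pos (hx i j hij)
  have hf : MemF (ensembleLaws ω i j) := by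
    rw [ensembleLaws_of_adj ω hij]; exact (ω (edgeOf hij)).2
  exact ((hasDifferential_dist2 (hx i j hij)).comp (hf.differentiableAt hd).hasDerivAt).mul
    (hasDifferential_dotp_sub i j _ x)

end Potential

/-! ### The kernel of the Hessian -/

section EdgeForm

variable {N : ℕ} {G : SimpleGraph (Fin N)}

/-- Half the rate of change of the squared edge lengths. -/
noncomputable def stretch (x u : Fin N → ℝ × ℝ) (e : G.edgeSet) : ℝ :=
  Sym2.lift ⟨fun i j => dotp (x i - x j) (u i - u j), fun i j => by
    simp only [dotp, Prod.fst_sub, Prod.snd_sub]; ring⟩ e.1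

theorem stretch_edgeOf (x u : Fin N → ℝ × ℝ) {i j : Fin N} (h : G.Adj i j) :
    stretch x u (edgeOf h) = dotp (x i - x j) (u i - u j) := rfl

/-- The product of the rates of rotation of the edges along two velocity fields, up to a factor. -/
noncomputable def swing (x u w : Fin N → ℝ × ℝ) (e : G.edgeSet) : ℝ :=
  Sym2.lift ⟨fun i j => crs (x i - x j) (u i - u j) * crs (x i - x j) (w i - w j), fun i j => by
    simp only [crs, Prod.fst_sub, Prod.snd_sub]; ring⟩ e.1

theorem swing_edgeOf (x u w : Fin N → ℝ × ℝ) {i j : Fin N} (h : G.Adj i j) :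
    swing x u w (edgeOf h) = crs (x i - x j) (u i - u j) * crs (x i - x j) (w i - w j) := rfl

theorem hessianForm_eq_sum_edgeSet (ω : G.edgeSet → FF) {x : Fin N → ℝ × ℝ}
    (hx : InConfigSpace G x) (u w : Fin N → ℝ × ℝ) :
    hessianForm ω x u w
      = ∑ e, ((ω e).1.1 (edgeLen x e) + edgeLen x e * deriv (ω e).1.1 (edgeLen x e))
            / edgeLen x e ^ 2 * (stretch x u e * stretch x w e)
        + ∑ e, tildeFn (ω e).1.1 (edgeLen x e) * (swing x u w e / edgeLen x e ^ 3) := by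
  rw [← Finset.sum_add_distrib, hessianForm, one_div, inv_mul_eq_iff_eq_mul₀ two_ne_zero,
    ← sum_adj_eq_two_mul_sum_edgeSet]
  refine Finset.sum_congr rfl fun i _ => Finset.sum_congr rfl fun j _ => ?_
  split_ifs with hij
  · have hd := dist2_pos (hx i j hij)
    have hL : dotp (x i - x j) (u i - u j) * dotp (x i - x j) (w i - w j)
        + crs (x i - x j) (u i - u j) * crs (x i - x j) (w i - w j)
        = dist2 (x i) (x j) ^ 2 * dotp (u i - u j) (w i - w j) := by
      rw [dist2_sq]; simp only [dotp, crs]; ring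
    rw [ensembleLaws_of_adj ω hij, edgeLen_edgeOf, stretch_edgeOf, stretch_edgeOf, swing_edgeOf,
      tildeFn]
    have hL' := eq_div_of_mul_eq (pow_ne_zero 2 hd.ne') ((mul_comm _ _).trans hL.symm)
    rw [hL']
    field_simp
    ring
  · rfl

theorem hessianForm_comm (ω : G.edgeSet → FF) (x u w : Fin N → ℝ × ℝ) :
    hessianForm ω x u w = hessianForm ω x w u := by
  refine congrArg _ (Finset.sum_congr rfl fun i _ => Finset.sum_congr rfl fun j _ => ?_)
  split_ifs
  · simp only [dotp]; ring
  · rfl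

/-- The linear form obtained from the second differential by fixing its first argument. -/
noncomputable def hessianFormRight (ω : G.edgeSet → FF) (x u : Fin N → ℝ × ℝ) :
    (Fin N → ℝ × ℝ) →ₗ[ℝ] ℝ where
  toFun := hessianForm ω x u
  map_add' w w' := by
    simp only [hessianForm, ← mul_add, ← Finset.sum_add_distrib]
    refine congrArg _ (Finset.sum_congr rfl fun i _ => Finset.sum_congr rfl fun j _ => ?_)
    split_ifs
    · simp only [dotp, Pi.add_apply, Prod.fst_sub, Prod.snd_sub, Prod.fst_add, Prod.snd_add]; ring
    · rw [add_zero]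
  map_smul' r w := by
    simp only [hessianForm, RingHom.id_apply, smul_eq_mul, Finset.mul_sum]
    refine Finset.sum_congr rfl fun i _ => Finset.sum_congr rfl fun j _ => ?_
    split_ifs
    · simp only [dotp, Pi.smul_apply, Prod.fst_sub, Prod.snd_sub, Prod.smul_fst, Prod.smul_snd,
        smul_eq_mul]
      ring
    · rw [mul_zero, mul_zero]

end EdgeForm

namespace ConstructionOrder

variable {N : ℕ} {G : SimpleGraph (Fin N)} (H : ConstructionOrder G)

theorem row_stretch {x : Fin N → ℝ × ℝ} (hx : InConfigSpace G x) {k : H.Idx}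
    (hk : H.orient x k = 0) (u : Fin N → ℝ × ℝ) :
    H.row (H.leftSign x) (H.rightSign x) k (fun e => stretch x u e / edgeLen x e) = 0 := by
  obtain ⟨ρ, hρ0, hρ1, hρ⟩ := H.exists_ratio hx hk
  exact elongation_relation (hx _ _ (H.adj_left_right k)) hρ0 hρ1 hρ _ _ _

theorem exists_row_swing {x : Fin N → ℝ × ℝ} (hx : InConfigSpace G x) {k : H.Idx}
    (hk : H.orient x k = 0) : ∃ m : ℝ, m ≠ 0 ∧ ∀ u w : Fin N → ℝ × ℝ,
      H.row (H.leftSign x) (H.rightSign x) k (fun e => swing x u w e / edgeLen x e ^ 3)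
        = m * (H.twist x u k * H.twist x w k) := by
  obtain ⟨ρ, hρ0, hρ1, hρ⟩ := H.exists_ratio hx hk
  have hyz := hx _ _ (H.adj_left_right k)
  exact ⟨_, inv_ne_zero (mul_ne_zero (mul_ne_zero (pow_ne_zero 3 (dist2_pos hyz).ne') hρ0)
    (sub_ne_zero.mpr hρ1.symm)), fun u w => stress_rank_one hyz hρ0 hρ1 hρ _ _ _ _ _ _⟩

/-- At an equilibrium of a generic ensemble, the second differential is diagonal in terms of the
elongation rates of the edges and the twists of the aligned triangles. -/
theorem exists_hessianForm_eq {ω : G.edgeSet → FF} (hω : ω ∈ H.genericEnsembles)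
    {x : Fin N → ℝ × ℝ} (hx : InConfigSpace G x) (he : IsEquilibrium G (ensembleLaws ω) x) :
    ∃ (a : G.edgeSet → ℝ) (m : H.Idx → ℝ), (∀ e, 0 < a e) ∧ (∀ k, H.orient x k = 0 → m k ≠ 0) ∧
      (∀ k, H.orient x k ≠ 0 → m k = 0) ∧ ∀ u w, hessianForm ω x u w
        = ∑ e, a e * (stretch x u e * stretch x w e)
          + ∑ k, m k * (H.twist x u k * H.twist x w k) := by
  obtain ⟨c, hc, hc', hsum⟩ := H.exists_multipliers hω hx he
  have h : ∀ k, ∃ m : ℝ, H.orient x k = 0 → m ≠ 0 ∧ ∀ u w : Fin N → ℝ × ℝ,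
      H.row (H.leftSign x) (H.rightSign x) k (fun e => swing x u w e / edgeLen x e ^ 3)
        = m * (H.twist x u k * H.twist x w k) := fun k => by
    by_cases hk : H.orient x k = 0
    · obtain ⟨m, hm⟩ := H.exists_row_swing hx hk
      exact ⟨m, fun _ => hm⟩
    · exact ⟨0, fun h => absurd h hk⟩
  choose m hm using h
  refine ⟨_, fun k => c k * m k, fun e => div_pos ((ω e).2.deriv_tildeFn_pos (edgeLen_pos hx e))
    (pow_pos (edgeLen_pos hx e) 2), fun k hk => mul_ne_zero (hc k hk) (hm k hk).1,
    fun k hk => mul_eq_zero_of_left (hc' k hk) _, fun u w => ?_⟩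
  rw [hessianForm_eq_sum_edgeSet ω hx, hsum]
  congr 1
  refine Finset.sum_congr rfl fun k _ => ?_
  by_cases hk : H.orient x k = 0
  · rw [(hm k hk).2, mul_assoc]
  · simp only [hc' k hk, zero_mul]

/-- At an equilibrium of a generic ensemble, the kernel of the second differential consists of the
infinitesimal rigid motions. -/
theorem hessianForm_eq_zero_iff {ω : G.edgeSet → FF} (hω : ω ∈ H.genericEnsembles)
    {x : Fin N → ℝ × ℝ} (hx : InConfigSpace G x) (he : IsEquilibrium G (ensembleLaws ω) x)
    {v : Fin N → ℝ × ℝ} :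
    (∀ w, hessianForm ω x v w = 0) ↔ ∃ t, v = rigidVelocity x t := by
  obtain ⟨a, m, ha, hm, hm', hform⟩ := H.exists_hessianForm_eq hω hx he
  constructor
  · intro h
    obtain ⟨w, hw, hw'⟩ := H.exists_velocities hx
      (g := fun e => stretch x v e / edgeLen x e) (fun k hk => H.row_stretch hx hk v)
      (fun k => m k * H.twist x v k)
    have hw1 : ∀ e : G.edgeSet, stretch x w e = stretch x v e := fun e => by
      obtain ⟨i, j, hij, rfl⟩ := exists_edgeOf e
      rw [stretch_edgeOf, hw i j hij, edgeLen_edgeOf, mul_div_cancel₀]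
      exact (dist2_pos (hx i j hij)).ne'
    have hzero : ∑ e, a e * (stretch x v e) ^ 2 + ∑ k, (m k * H.twist x v k) ^ 2 = 0 := by
      rw [← h w, hform]
      congr 1
      · exact Finset.sum_congr rfl fun e _ => by rw [hw1, sq]
      · refine Finset.sum_congr rfl fun k _ => ?_
        by_cases hk : H.orient x k = 0
        · rw [hw' k hk]; ring
        · rw [hm' k hk]; ring
    have h1 : ∀ e ∈ Finset.univ, 0 ≤ a e * (stretch x v e) ^ 2 :=
      fun e _ => mul_nonneg (ha e).le (sq_nonneg _)
    have h2 : ∀ k ∈ Finset.univ, 0 ≤ (m k * H.twist x v k) ^ 2 := fun k _ => sq_nonneg _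
    obtain ⟨h3, h4⟩ := (add_eq_zero_iff_of_nonneg (Finset.sum_nonneg h1)
      (Finset.sum_nonneg h2)).mp hzero
    rw [Finset.sum_eq_zero_iff_of_nonneg h1] at h3
    rw [Finset.sum_eq_zero_iff_of_nonneg h2] at h4
    refine H.exists_eq_rigidVelocity hx (fun i j hij => ?_) fun k hk => ?_
    · exact pow_eq_zero_iff two_ne_zero |>.mp
        ((mul_eq_zero.mp (h3 (edgeOf hij) (Finset.mem_univ _))).resolve_left (ha _).ne')
    · exact (mul_eq_zero.mp (pow_eq_zero_iff two_ne_zero |>.mp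
        (h4 k (Finset.mem_univ _)))).resolve_left (hm k hk)
  · rintro ⟨t, rfl⟩ w
    have h1 : ∀ e : G.edgeSet, stretch x (rigidVelocity x t) e = 0 := fun e => by
      obtain ⟨i, j, hij, rfl⟩ := exists_edgeOf e
      exact dotp_rigidVelocity x t i j
    simp only [hform, h1, H.twist_rigidVelocity, zero_mul, mul_zero, Finset.sum_const_zero,
      add_zero]

end ConstructionOrder

theorem Matrix.IsHermitian.n0_eq_finrank_ker {m : Type*} [Fintype m] [DecidableEq m]
    {M : Matrix m m ℝ} (hM : M.IsHermitian) :
    n0 M = Module.finrank ℝ (LinearMap.ker M.mulVecLin) := by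
  have h1 := hM.rank_eq_card_non_zero_eigs
  have h2 := LinearMap.finrank_range_add_finrank_ker M.mulVecLin
  have h3 : Fintype.card {i // hM.eigenvalues i = 0} + Fintype.card {i // hM.eigenvalues i ≠ 0}
      = Fintype.card m := by
    rw [Fintype.card_subtype_compl, add_tsub_cancel_of_le (Fintype.card_subtype_le _)]
  have h4 : n0 M = Fintype.card {i // hM.eigenvalues i = 0} := by
    rw [n0, inertia, dif_pos hM, Fintype.card_subtype]
  rw [Matrix.rank] at h1
  rw [Module.finrank_fintype_fun_eq_card] at h2
  omega

/-- The configuration with prescribed coordinates `(a₁,…,a_N,b₁,…,b_N)`. -/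
def coordEquiv (N : ℕ) : (Fin N ⊕ Fin N → ℝ) ≃ₗ[ℝ] (Fin N → ℝ × ℝ) where
  toFun y i := (y (Sum.inl i), y (Sum.inr i))
  invFun v := Sum.elim (fun i => (v i).1) fun i => (v i).2
  map_add' _ _ := rfl
  map_smul' _ _ := rfl
  left_inv y := by ext (i | i) <;> rfl
  right_inv v := rfl

theorem coordEquiv_apply {N : ℕ} (y : Fin N ⊕ Fin N → ℝ) (i : Fin N) :
    coordEquiv N y i = (y (Sum.inl i), y (Sum.inr i)) := rfl

theorem coordEquiv_eq_sum {N : ℕ} (y : Fin N ⊕ Fin N → ℝ) :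
    coordEquiv N y = ∑ u, y u • basisVec u := by
  ext i
  · simp [coordEquiv_apply, basisVec, Finset.sum_apply, Pi.single_apply]
  · simp [coordEquiv_apply, basisVec, Finset.sum_apply, Pi.single_apply]

namespace ConstructionOrder

variable {N : ℕ} {G : SimpleGraph (Fin N)} (H : ConstructionOrder G)

theorem hessian_mulVec (ω : G.edgeSet → FF) {x : Fin N → ℝ × ℝ} (hx : InConfigSpace G x)
    (y : Fin N ⊕ Fin N → ℝ) (u : Fin N ⊕ Fin N) :
    (hessian (potential G (ensembleLaws ω)) x *ᵥ y) u
      = hessianForm ω x (coordEquiv N y) (basisVec u) := by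
  have h : hessianForm ω x (basisVec u) (coordEquiv N y)
      = hessianFormRight ω x (basisVec u) (coordEquiv N y) := rfl
  rw [hessianForm_comm, h, coordEquiv_eq_sum, map_sum]
  rw [Matrix.mulVec, dotProduct]
  refine Finset.sum_congr rfl fun v _ => ?_
  rw [map_smul, hessian_potential ω hx, smul_eq_mul, mul_comm]
  rfl

theorem n0_hessian {ω : G.edgeSet → FF} (hω : ω ∈ H.genericEnsembles)
    {x : Fin N → ℝ × ℝ} (hx : InConfigSpace G x) (he : IsEquilibrium G (ensembleLaws ω) x) :
    n0 (hessian (potential G (ensembleLaws ω)) x) = 3 := by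
  have hM : (hessian (potential G (ensembleLaws ω)) x).IsHermitian :=
    Matrix.IsHermitian.ext fun u v => by
      rw [hessian_potential ω hx, hessian_potential ω hx, hessianForm_comm]
      rfl
  have hker : LinearMap.ker (hessian (potential G (ensembleLaws ω)) x).mulVecLin
      = (LinearMap.range (rigidVelocity x)).map
        ((coordEquiv N).symm : (Fin N → ℝ × ℝ) →ₗ[ℝ] _) := by
    ext y
    rw [Submodule.mem_map_equiv, LinearEquiv.symm_symm, LinearMap.mem_range, LinearMap.mem_ker,
      Matrix.mulVecLin_apply]
    simp only [eq_comm (b := coordEquiv N y)]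
    rw [← H.hessianForm_eq_zero_iff hω hx he]
    refine ⟨fun h w => ?_, fun h => funext fun u => (hessian_mulVec ω hx y u).trans (h _)⟩
    obtain ⟨z, rfl⟩ := (coordEquiv N).surjective w
    have h' : hessianForm ω x (coordEquiv N y) (coordEquiv N z)
      = hessianFormRight ω x (coordEquiv N y) (coordEquiv N z) := rfl
    rw [h', coordEquiv_eq_sum z, map_sum]
    refine Finset.sum_eq_zero fun u _ => ?_
    rw [map_smul]
    have h0 : hessianFormRight ω x (coordEquiv N y) (basisVec u) = 0 :=
      (hessian_mulVec ω hx y u).symm.trans (congrFun h u)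
    rw [h0, smul_zero]
  rw [hM.n0_eq_finrank_ker, hker, LinearEquiv.finrank_map_eq,
    LinearMap.finrank_range_of_inj (rigidVelocity_injective (hx _ _ H.adj_base))]
  simp

/-! ### Finiteness of the set of critical orbits -/

/-- Equilibria with the same combinatorial type lie in the same orbit. -/
theorem sameOrbit_of_type_eq {ω : G.edgeSet → FF} {x y : Fin N → ℝ × ℝ}
    (hx : InConfigSpace G x) (hex : IsEquilibrium G (ensembleLaws ω) x)
    (hy : InConfigSpace G y) (hey : IsEquilibrium G (ensembleLaws ω) y)
    (ho : ∀ k, SignType.sign (H.orient y k) = SignType.sign (H.orient x k))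
    (hl : H.leftSign y = H.leftSign x) (hr : H.rightSign y = H.rightSign x) : sameOrbit x y := by
  have ha : H.aligned y = H.aligned x := Set.ext fun k => by
    rw [aligned, aligned, mem_ofPred_eq, mem_ofPred_eq, ← sign_eq_zero_iff, ho, sign_eq_zero_iff]
  have h1 := H.isBalanced_edgeLen hy hey
  rw [ha, hl, hr] at h1
  have h2 := h1.eq (H.isBalanced_edgeLen hx hex)
  exact H.sameOrbit_of_dist2_eq hx (fun i j hij => congrFun h2 (edgeOf hij)) ho

end ConstructionOrder

theorem sameOrbit.dist2_eq {N : ℕ} {x y : Fin N → ℝ × ℝ} (h : sameOrbit x y) (i j : Fin N) :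
    dist2 (y i) (y j) = dist2 (x i) (x j) := by
  obtain ⟨c, s, a, b, hcs, h⟩ := h
  rw [dist2, dist2, h i, h j]
  congr 1
  linear_combination (((x i).1 - (x j).1) ^ 2 + ((x i).2 - (x j).2) ^ 2) * hcs

theorem sameOrbit.inConfigSpace {N : ℕ} {G : SimpleGraph (Fin N)} {x y : Fin N → ℝ × ℝ}
    (h : sameOrbit x y) (hx : InConfigSpace G x) : InConfigSpace G y := fun i j hij hy => by
  have h1 := dist2_pos (hx i j hij)
  rw [← h.dist2_eq, hy, dist2, sub_self, sub_self] at h1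
  simp at h1

theorem sameOrbit.isEquilibrium {N : ℕ} {G : SimpleGraph (Fin N)} {f : Fin N → Fin N → ℝ → ℝ}
    {x y : Fin N → ℝ × ℝ} (h : sameOrbit x y) (hx : IsEquilibrium G f x) :
    IsEquilibrium G f y := fun i => by
  have hd := h.dist2_eq
  obtain ⟨c, s, a, b, hcs, h⟩ := h
  let R : ℝ × ℝ →+ ℝ × ℝ :=
    { toFun := fun z => (c * z.1 - s * z.2, s * z.1 + c * z.2)
      map_zero' := by simp
      map_add' := fun z z' => by ext <;> simp only [Prod.fst_add, Prod.snd_add] <;> ring }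
  refine Eq.trans ?_ ((congrArg R (hx i)).trans (map_zero R))
  rw [map_sum]
  refine Finset.sum_congr rfl fun j _ => ?_
  split_ifs
  · rw [hd, h i, h j]
    ext
    · change f i j _ * _ = c * (f i j _ * ((x j).1 - (x i).1)) - s * (f i j _ * ((x j).2 - (x i).2))
      simp only [Prod.fst_sub]
      ring
    · change f i j _ * _ = s * (f i j _ * ((x j).1 - (x i).1)) + c * (f i j _ * ((x j).2 - (x i).2))
      simp only [Prod.snd_sub]
      ring
  · exact (map_zero R).symm

/-- Finitely many equilibria represent all critical orbits. -/
theorem ConstructionOrder.exists_representatives {N : ℕ} {G : SimpleGraph (Fin N)}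
    (H : ConstructionOrder G) (ω : G.edgeSet → FF) :
    ∃ (k : ℕ) (reps : Fin k → (Fin N → ℝ × ℝ)), (∀ t, InConfigSpace G (reps t)) ∧
      {p | InConfigSpace G p ∧ IsEquilibrium G (ensembleLaws ω) p}
        = ⋃ t, {q | sameOrbit (reps t) q} := by
  let τ : (Fin N → ℝ × ℝ) → (H.Idx → SignType) × (H.Idx → Bool) × (H.Idx → Bool) :=
    fun x => (fun k => SignType.sign (H.orient x k), H.leftSign x, H.rightSign x)
  set S := {p | InConfigSpace G p ∧ IsEquilibrium G (ensembleLaws ω) p} with hS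
  have hfin : Finite (τ '' S) := inferInstance
  obtain ⟨k, ⟨ε⟩⟩ := Finite.exists_equiv_fin (τ '' S)
  have hchoice : ∀ t : Fin k, ∃ p ∈ S, τ p = (ε.symm t).1 := fun t => (ε.symm t).2
  choose reps hreps hτ using hchoice
  refine ⟨k, reps, fun t => (hreps t).1, Set.ext fun q => ?_⟩
  rw [mem_iUnion]
  refine ⟨fun hq => ?_, fun ⟨t, ht⟩ => ⟨sameOrbit.inConfigSpace ht (hreps t).1,
    sameOrbit.isEquilibrium ht (hreps t).2⟩⟩
  refine ⟨ε ⟨τ q, mem_image_of_mem τ hq⟩, ?_⟩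
  have h := hτ (ε ⟨τ q, mem_image_of_mem τ hq⟩)
  rw [ε.symm_apply_apply] at h
  have h' := hreps (ε ⟨τ q, mem_image_of_mem τ hq⟩)
  exact H.sameOrbit_of_type_eq h'.1 h'.2 hq.1 hq.2 (fun k => congrFun (congrArg Prod.fst h.symm) k)
    (congrArg (fun z => z.2.1) h.symm) (congrArg (fun z => z.2.2) h.symm)

/-- For a triangulated Laman graph `G` on `N ≥ 2` vertices, generically in the
ensemble of interaction laws `ω ∈ 𝓕^{|E|}` the potential `Φ` is an equivariant Morse function:
there are only finitely many critical orbits, and every critical orbit is nondegenerate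
(the Hessian of `Φ` there has exactly three zero eigenvalues). -/
theorem statement0 {N : ℕ} (hN : 2 ≤ N) (G : SimpleGraph (Fin N)) (hG : IsTLG G) :
    ∃ U : Set (G.edgeSet → FF), IsOpen U ∧ Dense U ∧
      ∀ ω ∈ U,
        (∃ (k : ℕ) (reps : Fin k → (Fin N → ℝ × ℝ)),
          (∀ t, InConfigSpace G (reps t)) ∧
          {p | InConfigSpace G p ∧ IsEquilibrium G (ensembleLaws ω) p}
            = ⋃ t, {q | sameOrbit (reps t) q}) ∧
        (∀ p : Fin N → ℝ × ℝ, InConfigSpace G p → IsEquilibrium G (ensembleLaws ω) p →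
          n0 (hessian (potential G (ensembleLaws ω)) p) = 3) := by
  obtain ⟨H⟩ := hG.nonempty_constructionOrder
  obtain ⟨hopen, hdense⟩ := H.isOpen_dense_genericEnsembles
  exact ⟨H.genericEnsembles, hopen, hdense, fun ω hω =>
    ⟨H.exists_representatives ω, fun p hp he => H.n0_hessian hω hp he⟩⟩
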